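/- arXiv:1406.3993 — 3 statements merged into one kernel-verified Lean document; each statement's English description precedes it below -/
import Mathlib

section
/- Let n be a natural number, let R = ℤ[x₁,…,xₙ] be the polynomial ring over ℤ in n variables, let S be a commutative ring equipped with a ring homomorphism φ : R → S making S a free R-module, and let ε : S → ℤ be a ring homomorphism, so that ℤ is an S-module via ε and an R-module via ε ∘ φ. Then for every p ≥ 0 the abelian group Tor_p^S(ℤ, S ⊗_R ℤ) is a free abelian group of rank (n choose p). -/
open CategoryTheory
open scoped Pointwise

def HasKos {A : Type} [CommRing A] (I : Ideal A) (m : ℕ) (M : Type) [AddCommGroup M]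
    [Module A M] : Prop :=
  ∃ (K : ℕ → ModuleCat.{0} A) (d : ∀ p, K (p + 1) →ₗ[A] K p) (π : K 0 →ₗ[A] M),
    (∀ p, Nonempty (K p ≃ₗ[A] (Fin (m.choose p) → A))) ∧ Function.Surjective π ∧
    Function.Exact (d 0) π ∧ (∀ p, Function.Exact (d (p + 1)) (d p)) ∧
    ∀ p x, d p x ∈ I • (⊤ : Submodule A (K p))

section Step
variable {A : Type} [CommRing A]

def baseK (A : Type) [CommRing A] : ℕ → ModuleCat.{0} A
  | 0 => ModuleCat.of A A
  | _ + 1 => ModuleCat.of A PUnit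

lemma HasKos.base (I : Ideal A) : HasKos I 0 A := by
  refine ⟨baseK A, fun p => 0, (LinearMap.id : A →ₗ[A] A), ?_, ?_, ?_, ?_, ?_⟩
  · rintro (_ | p)
    · exact ⟨(LinearEquiv.funUnique (Fin 1) A A).symm⟩
    · have : IsEmpty (Fin (Nat.choose 0 (p + 1))) := by simp; infer_instance
      exact ⟨(0 : PUnit ≃ₗ[A] (Fin (Nat.choose 0 (p + 1)) → A))⟩
  · exact fun x => ⟨x, rfl⟩
  · intro x
    constructor
    · intro h; exact ⟨0, h.symm⟩
    · rintro ⟨y, rfl⟩; rfl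
  · intro p x
    constructor
    · intro _; exact ⟨0, rfl⟩
    · intro _; simp
  · intro p x; simp

def stepK (K : ℕ → ModuleCat.{0} A) : ℕ → ModuleCat.{0} A
  | 0 => K 0
  | p + 1 => ModuleCat.of A (K (p + 1) × K p)

def stepD (K : ℕ → ModuleCat.{0} A) (d : ∀ p, K (p + 1) →ₗ[A] K p) (r : A) :
    ∀ p, stepK K (p + 1) →ₗ[A] stepK K p
  | 0 => (LinearMap.coprod (d 0) (r • LinearMap.id) : (K 1 × K 0) →ₗ[A] K 0)
  | p + 1 => (LinearMap.prod (LinearMap.coprod (d (p + 1)) (r • LinearMap.id))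
      (- (d p) ∘ₗ LinearMap.snd A _ _) : (K (p + 2) × K (p + 1)) →ₗ[A] (K (p + 1) × K p))

lemma stepD_zero (K : ℕ → ModuleCat.{0} A) (d : ∀ p, K (p + 1) →ₗ[A] K p) (r : A)
    (a : K 1) (b : K 0) : stepD K d r 0 ((a, b) : K 1 × K 0) = (d 0 a + r • b : K 0) := by
  simp [stepD]; rfl

lemma stepD_succ (K : ℕ → ModuleCat.{0} A) (d : ∀ p, K (p + 1) →ₗ[A] K p) (r : A) (p : ℕ)
    (a : K (p + 2)) (b : K (p + 1)) : stepD K d r (p + 1) ((a, b) : K (p + 2) × K (p + 1)) =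
      ((d (p + 1) a + r • b, - d p b) : K (p + 1) × K p) := by
  rfl

lemma mem_smul_prod (I : Ideal A) {M N : Type} [AddCommGroup M] [Module A M]
    [AddCommGroup N] [Module A N] {x : M} {y : N} (hx : x ∈ I • (⊤ : Submodule A M))
    (hy : y ∈ I • (⊤ : Submodule A N)) : (x, y) ∈ I • (⊤ : Submodule A (M × N)) := by
  have h1 : LinearMap.inl A M N x ∈ I • (⊤ : Submodule A (M × N)) :=
    Submodule.smul_top_le_comap_smul_top I (LinearMap.inl A M N) hx
  have h2 : LinearMap.inr A M N y ∈ I • (⊤ : Submodule A (M × N)) :=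
    Submodule.smul_top_le_comap_smul_top I (LinearMap.inr A M N) hy
  simpa using add_mem h1 h2

lemma HasKos.step {I : Ideal A} {m : ℕ} {M : Type} [AddCommGroup M] [Module A M]
    (h : HasKos I m M) {r : A} (hr : IsSMulRegular M r) (hI : r ∈ I) :
    HasKos I (m + 1) (QuotSMulTop r M) := by
  obtain ⟨K, d, π, hK, hs, h0, hd, hm⟩ := h
  refine ⟨stepK K, stepD K d r, (Submodule.mkQ _ ∘ₗ π : K 0 →ₗ[A] _), ?_, ?_, ?_, ?_, ?_⟩
  · rintro (_ | p)
    · obtain ⟨e⟩ := hK 0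
      exact ⟨e.trans (LinearEquiv.funCongrLeft A A (finCongr (by simp)))⟩
    · obtain ⟨e⟩ := hK (p + 1)
      obtain ⟨f⟩ := hK p
      refine ⟨((e.prodCongr f).trans (LinearEquiv.sumArrowLequivProdArrow _ _ A A).symm).trans
        (LinearEquiv.funCongrLeft A A ((finCongr ?_).trans finSumFinEquiv.symm))⟩
      rw [Nat.choose_succ_succ, add_comm]
  · exact (Submodule.mkQ_surjective _).comp hs
  · intro (x : K 0)
    change Submodule.mkQ (r • (⊤ : Submodule A M)) (π x) = 0 ↔ _
    rw [Submodule.mkQ_apply, Submodule.Quotient.mk_eq_zero, Submodule.mem_smul_pointwise_iff_exists]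
    constructor
    · rintro ⟨y, -, hy⟩
      obtain ⟨b, rfl⟩ := hs y
      obtain ⟨a, ha⟩ := (h0 (x - r • b)).1 (by simp [hy])
      refine ⟨((a, b) : K 1 × K 0), ?_⟩
      rw [stepD_zero, ha]; simp; rfl
    · rintro ⟨⟨a, b⟩, rfl⟩
      refine ⟨π b, trivial, ?_⟩
      erw [stepD_zero]
      rw [map_add, h0.apply_apply_eq_zero, map_smul, zero_add]
  · rintro (_ | p)
    · rintro ⟨a, b⟩
      constructor
      · intro h
        erw [stepD_zero] at h
        have hb : π b = 0 := by
          apply hr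
          have := congrArg π h
          rw [map_add, h0.apply_apply_eq_zero, map_smul, zero_add] at this
          simpa using this.trans (map_zero π)
        obtain ⟨c, rfl⟩ := (h0 b).1 hb
        obtain ⟨e, he⟩ := (hd 0 (a + r • c)).1 (by rw [map_add, map_smul]; exact h)
        refine ⟨((e, -c) : K 2 × K 1), ?_⟩
        rw [stepD_succ, he]
        simp
        rfl
      · rintro ⟨⟨e, c⟩, h⟩
        erw [stepD_succ] at h
        rw [← h]
        erw [stepD_zero]
        rw [map_add, (hd 0).apply_apply_eq_zero]
        simp
        rfl
    · rintro ⟨a, b⟩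
      constructor
      · intro h
        erw [stepD_succ] at h
        obtain ⟨h1, h2⟩ := Prod.mk.inj h
        obtain ⟨c, rfl⟩ := (hd p b).1 (neg_eq_zero.1 h2)
        obtain ⟨e, he⟩ := (hd (p + 1) (a + r • c)).1 (by rw [map_add, map_smul]; exact h1)
        refine ⟨((e, -c) : K (p + 3) × K (p + 2)), ?_⟩
        rw [stepD_succ, he]
        simp
        rfl
      · rintro ⟨⟨e, c⟩, h⟩
        erw [stepD_succ] at h
        rw [← h]
        erw [stepD_succ]
        rw [map_add, (hd (p + 1)).apply_apply_eq_zero, map_neg, (hd p).apply_apply_eq_zero]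
        simp
        rfl
  · rintro (_ | p) ⟨a, b⟩
    · erw [stepD_zero]
      exact add_mem (hm _ _) (Submodule.smul_mem_smul hI trivial)
    · erw [stepD_succ]
      exact mem_smul_prod I (add_mem (hm _ _) (Submodule.smul_mem_smul hI trivial))
        (neg_mem (hm _ _))

lemma HasKos.congr {I : Ideal A} {m : ℕ} {M N : Type} [AddCommGroup M] [Module A M]
    [AddCommGroup N] [Module A N] (h : HasKos I m M) (e : M ≃ₗ[A] N) : HasKos I m N := by
  obtain ⟨K, d, π, hK, hs, h0, hd, hm⟩ := h
  refine ⟨K, d, e.toLinearMap ∘ₗ π, hK, e.surjective.comp hs, ?_, hd, hm⟩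
  intro x
  rw [← h0 x]; simp

open RingTheory.Sequence in
lemma HasKos.list (I : Ideal A) (rs : List A) : ∀ (m : ℕ) (M : Type) [AddCommGroup M] [Module A M],
    HasKos I m M → IsWeaklyRegular M rs → (∀ r ∈ rs, r ∈ I) →
    HasKos I (m + rs.length) (M ⧸ (Ideal.ofList rs • ⊤ : Submodule A M)) := by
  induction rs with
  | nil =>
    intro m M _ _ h _ _
    exact h.congr (Submodule.quotEquivOfEqBot _ (by simp)).symm
  | cons r rs ih =>
    intro m M _ _ h hr hI
    rw [isWeaklyRegular_cons_iff] at hr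
    have := ih (m + 1) _ (h.step hr.1 (hI r (by simp))) hr.2 (fun s hs => hI s (by simp [hs]))
    have h2 := this.congr (Submodule.quotOfListConsSMulTopEquivQuotSMulTopInner M r rs).symm
    rwa [add_assoc, add_comm 1] at h2
end Step

section Reg
open MvPolynomial RingTheory.Sequence

noncomputable def killFirst (n : ℕ) (c : ℤ) :
    MvPolynomial (Fin (n + 1)) ℤ →+* MvPolynomial (Fin n) ℤ :=
  (aeval (Fin.cons (C c) X : Fin (n + 1) → MvPolynomial (Fin n) ℤ)).toRingHom

lemma killFirst_sub (n : ℕ) (c : ℤ) (p : MvPolynomial (Fin (n + 1)) ℤ) :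
    p - rename Fin.succ (killFirst n c p) ∈ Ideal.span {(X 0 - C c : MvPolynomial (Fin (n + 1)) ℤ)} := by
  rw [← Ideal.Quotient.eq]
  have : (Ideal.Quotient.mk (Ideal.span {(X 0 - C c : MvPolynomial (Fin (n + 1)) ℤ)})) =
     ((Ideal.Quotient.mk _).comp (rename Fin.succ).toRingHom).comp (killFirst n c) := by
    apply MvPolynomial.ringHom_ext
    · intro r; simp 
    · intro i
      refine Fin.cases ?_ (fun i => ?_) i
      · simp only [killFirst, RingHom.comp_apply]
        simp only [AlgHom.toRingHom_eq_coe, RingHom.coe_coe, aeval_X, Fin.cons_zero]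
        rw [Ideal.Quotient.eq]
        simp
      · simp [killFirst]
  exact congrArg (fun f : _ →+* _ => f p) this

lemma isWeaklyRegular_X_sub_C : ∀ (n : ℕ) (a : Fin n → ℤ),
    IsWeaklyRegular (MvPolynomial (Fin n) ℤ)
      (List.ofFn fun i => (X i - C (a i) : MvPolynomial (Fin n) ℤ)) := by
  intro n
  induction n with
  | zero => intro a; simp
  | succ n ih =>
    intro a
    rw [List.ofFn_succ]
    have hne : (X 0 - C (a 0) : MvPolynomial (Fin (n + 1)) ℤ) ≠ 0 := by
      intro h
      have := congrArg (eval (fun _ => a 0 + 1)) h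
      simp at this
    refine IsWeaklyRegular.cons ?_ ?_
    · intro x y h
      exact mul_left_cancel₀ hne h
    · let f := killFirst n (a 0)
      let g : MvPolynomial (Fin (n + 1)) ℤ →ₛₗ[f] MvPolynomial (Fin n) ℤ := f.toSemilinearMap
      have hg : ∀ x, g x = f x := fun _ => rfl
      have hle : (X 0 - C (a 0) : MvPolynomial (Fin (n + 1)) ℤ) •
          (⊤ : Submodule (MvPolynomial (Fin (n + 1)) ℤ) (MvPolynomial (Fin (n + 1)) ℤ)) ≤
          LinearMap.ker g := by
        intro x hx
        rw [Submodule.mem_smul_pointwise_iff_exists] at hx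
        obtain ⟨y, -, rfl⟩ := hx
        rw [LinearMap.mem_ker, hg, smul_eq_mul, map_mul]
        simp [f, killFirst]
      let h := Submodule.liftQ _ g hle
      have hsurj : Function.Surjective h := by
        intro y
        refine ⟨Submodule.Quotient.mk (rename Fin.succ y), ?_⟩
        change killFirst n (a 0) _ = _
        simp only [killFirst, AlgHom.toRingHom_eq_coe, RingHom.coe_coe, aeval_rename]
        simp [Function.comp_def]
      have hinj : Function.Injective h := by
        rw [← LinearMap.ker_eq_bot]
        apply Submodule.ker_liftQ_eq_bot
        intro x hx
        have := killFirst_sub n (a 0) x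
        rw [show killFirst n (a 0) x = 0 from hx, map_zero, sub_zero,
          Ideal.mem_span_singleton] at this
        obtain ⟨y, rfl⟩ := this
        exact Submodule.smul_mem_pointwise_smul y _ _ trivial
      let e : QuotSMulTop (X 0 - C (a 0) : MvPolynomial (Fin (n + 1)) ℤ)
          (MvPolynomial (Fin (n + 1)) ℤ) ≃+ MvPolynomial (Fin n) ℤ :=
        AddEquiv.ofBijective h.toAddMonoidHom ⟨hinj, hsurj⟩
      refine (AddEquiv.isWeaklyRegular_congr (e := e)
        (bs := List.ofFn fun i => (X i - C (a i.succ) : MvPolynomial (Fin n) ℤ)) ?_).2 (ih _)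
      rw [List.forall₂_iff_get]
      refine ⟨by simp, ?_⟩
      intro i h1 h2 x
      refine (h.map_smulₛₗ _ x).trans ?_
      congr 1
      simp [f, killFirst]
      rfl

lemma ker_eq_ofList (n : ℕ) (ψ : MvPolynomial (Fin n) ℤ →+* ℤ) :
    RingHom.ker ψ = Ideal.ofList (List.ofFn fun i => (X i - C (ψ (X i)) : MvPolynomial (Fin n) ℤ)) := by
  set J := Ideal.ofList (List.ofFn fun i => (X i - C (ψ (X i)) : MvPolynomial (Fin n) ℤ)) with hJ
  apply le_antisymm
  · have : Ideal.Quotient.mk J = ((Ideal.Quotient.mk J).comp C).comp ψ := by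
      apply MvPolynomial.ringHom_ext
      · intro r; simp
      · intro i
        simp only [RingHom.comp_apply]
        rw [Ideal.Quotient.eq]
        exact Ideal.subset_span (by simp)
    intro x hx
    rw [← Ideal.Quotient.eq_zero_iff_mem, this]
    simp [RingHom.mem_ker.1 hx]
  · refine Ideal.span_le.2 ?_
    intro x hx
    obtain ⟨i, rfl⟩ := by simpa using hx
    simp [RingHom.mem_ker]
end Reg

section TorPart
open CategoryTheory CategoryTheory.Limits TensorProduct

lemma HasKos.baseChange {A S : Type} [CommRing A] [CommRing S] [Algebra A S] [Module.Flat A S]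
    {I : Ideal A} {J : Ideal S} (hIJ : ∀ r ∈ I, algebraMap A S r ∈ J) {m : ℕ} {M : Type}
    [AddCommGroup M] [Module A M] (h : HasKos I m M) : HasKos J m (S ⊗[A] M) := by
  obtain ⟨K, d, π, hK, hs, h0, hd, hm⟩ := h
  refine ⟨fun p => ModuleCat.of S (S ⊗[A] K p), fun p => (d p).baseChange S, π.baseChange S,
    ?_, ?_, ?_, ?_, ?_⟩
  · intro p
    obtain ⟨e⟩ := hK p
    exact ⟨(e.baseChange A S _ _).trans (TensorProduct.piScalarRight A S S _)⟩
  · exact LinearMap.lTensor_surjective S hs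
  · exact Module.Flat.lTensor_exact S h0
  · intro p; exact Module.Flat.lTensor_exact S (hd p)
  · intro p x
    change (d p).baseChange S x ∈ J • (⊤ : Submodule S (S ⊗[A] K p))
    change S ⊗[A] K (p + 1) at x
    induction x with
    | zero => simp
    | add x y hx hy => rw [map_add]; exact add_mem hx hy
    | tmul s y =>
      rw [LinearMap.baseChange_tmul]
      refine Submodule.smul_induction_on (p := fun z => s ⊗ₜ[A] z ∈ J • (⊤ : Submodule S (S ⊗[A] K p)))
        (hm p y) ?_ ?_
      · intro r hr z _
        rw [TensorProduct.tmul_smul, ← algebraMap_smul S r (s ⊗ₜ[A] z)]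
        exact Submodule.smul_mem_smul (hIJ r hr) trivial
      · intro u v hu hv
        rw [TensorProduct.tmul_add]; exact add_mem hu hv

variable {S : Type} [CommRing S]

noncomputable def kosComplex (K : ℕ → ModuleCat.{0} S) (d : ∀ p, K (p + 1) →ₗ[S] K p)
    (hd : ∀ p, Function.Exact (d (p + 1)) (d p)) : ChainComplex (ModuleCat.{0} S) ℕ :=
  ChainComplex.of K (fun p => ModuleCat.ofHom (d p)) (fun p => by
    ext x; exact (hd p).apply_apply_eq_zero x)

lemma kosComplex_d (K : ℕ → ModuleCat.{0} S) (d : ∀ p, K (p + 1) →ₗ[S] K p)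
    (hd : ∀ p, Function.Exact (d (p + 1)) (d p)) (p : ℕ) :
    (kosComplex K d hd).d (p + 1) p = ModuleCat.ofHom (d p) :=
  ChainComplex.of_d K (fun p => ModuleCat.ofHom (d p)) p

noncomputable def kosπ (K : ℕ → ModuleCat.{0} S) (d : ∀ p, K (p + 1) →ₗ[S] K p)
    (hd : ∀ p, Function.Exact (d (p + 1)) (d p)) (M : ModuleCat.{0} S) (π : K 0 →ₗ[S] M)
    (h0 : Function.Exact (d 0) π) :
    kosComplex K d hd ⟶ (ChainComplex.single₀ _).obj M :=
  (ChainComplex.toSingle₀Equiv _ _).symm ⟨ModuleCat.ofHom π, by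
    rw [kosComplex_d]; ext x; exact h0.apply_apply_eq_zero x⟩

lemma kosπ_f (K : ℕ → ModuleCat.{0} S) (d : ∀ p, K (p + 1) →ₗ[S] K p)
    (hd : ∀ p, Function.Exact (d (p + 1)) (d p)) (M : ModuleCat.{0} S) (π : K 0 →ₗ[S] M)
    (h0 : Function.Exact (d 0) π) : (kosπ K d hd M π h0).f 0 = ModuleCat.ofHom π :=
  ChainComplex.toSingle₀Equiv_symm_apply_f_zero _ _

lemma kos_quasiIso (K : ℕ → ModuleCat.{0} S) (d : ∀ p, K (p + 1) →ₗ[S] K p)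
    (hd : ∀ p, Function.Exact (d (p + 1)) (d p)) (M : ModuleCat.{0} S) (π : K 0 →ₗ[S] M)
    (h0 : Function.Exact (d 0) π) (hs : Function.Surjective π) :
    QuasiIso (kosπ K d hd M π h0) := by
  refine ⟨fun n => ?_⟩
  cases n with
  | zero =>
    rw [ChainComplex.quasiIsoAt₀_iff, ShortComplex.quasiIso_iff_of_zeros' _ rfl rfl rfl]
    constructor
    · rw [ShortComplex.ShortExact.moduleCat_exact_iff_function_exact]
      change Function.Exact ((kosComplex K d hd).d 1 0) ((kosπ K d hd M π h0).f 0)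
      rw [kosComplex_d, kosπ_f]
      exact h0
    · change Epi ((kosπ K d hd M π h0).f 0)
      rw [kosπ_f]
      exact (ModuleCat.epi_iff_surjective _).2 hs
  | succ m =>
    rw [quasiIsoAt_iff_exactAt' (hL := ChainComplex.exactAt_succ_single_obj ..),
      HomologicalComplex.exactAt_iff' _ (m + 2) (m + 1) m (by simp) (by simp),
      ShortComplex.ShortExact.moduleCat_exact_iff_function_exact]
    change Function.Exact ((kosComplex K d hd).d (m + 2) (m + 1)) ((kosComplex K d hd).d (m + 1) m)
    rw [kosComplex_d, kosComplex_d]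
    exact hd m

lemma homology_of_d_zero (C : ChainComplex (ModuleCat.{0} S) ℕ)
    (h : ∀ p, C.d (p + 1) p = 0) (p : ℕ) : Nonempty (C.homology p ≅ C.X p) := by
  have h' : ∀ i j, C.d i j = 0 := by
    intro i j
    by_cases hij : (ComplexShape.down ℕ).Rel i j
    · obtain rfl : j + 1 = i := hij
      exact h j
    · exact C.shape _ _ hij
  exact ⟨(ShortComplex.HomologyData.ofZeros (C.sc p) (h' _ _) (h' _ _)).left.homologyIso⟩

lemma HasKos.tor (ε : S →+* ℤ) {m : ℕ} (M : ModuleCat.{0} S)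
    (h : HasKos (RingHom.ker ε) m M) (p : ℕ) :
    Nonempty ((((Tor (ModuleCat S) p).obj
      ((ModuleCat.restrictScalars ε).obj (ModuleCat.of ℤ ℤ))).obj M) ≃+
      (Fin (m.choose p) → ℤ)) := by
  obtain ⟨K, d, π, hK, hs, h0, hd, hm⟩ := h
  let Z : ModuleCat.{0} S := (ModuleCat.restrictScalars ε).obj (ModuleCat.of ℤ ℤ)
  have hZ : ∀ (r : S), r ∈ RingHom.ker ε → ∀ z : Z, r • z = 0 := by
    intro r hr z
    change ε r * (show ℤ from z) = 0
    rw [RingHom.mem_ker.1 hr, zero_mul]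
  have hproj : ∀ n, Projective (K n) := by
    intro n
    obtain ⟨e⟩ := hK n
    have : Module.Projective S (K n) := Module.Projective.of_equiv e.symm
    exact (IsProjective.iff_projective (R := S) (K n)).1 this
  let P : ProjectiveResolution M :=
    { complex := kosComplex K d hd
      projective := hproj
      π := kosπ K d hd M π h0
      quasiIso := kos_quasiIso K d hd M π h0 hs }
  let F := (MonoidalCategory.tensoringLeft (ModuleCat.{0} S)).obj Z
  let C := (F.mapHomologicalComplex (ComplexShape.down ℕ)).obj P.complex
  have hC : ∀ q, C.d (q + 1) q = 0 := by
    intro q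
    change F.map ((kosComplex K d hd).d (q + 1) q) = 0
    rw [kosComplex_d]
    apply ModuleCat.hom_ext
    change LinearMap.lTensor Z (d q) = 0
    apply TensorProduct.ext'
    intro z x
    rw [LinearMap.lTensor_tmul, LinearMap.zero_apply]
    refine Submodule.smul_induction_on (p := fun y => z ⊗ₜ[S] y = (0 : Z ⊗[S] K q)) (hm q x) ?_ ?_
    · intro r hr y _
      rw [TensorProduct.tmul_smul, TensorProduct.smul_tmul', hZ r hr, TensorProduct.zero_tmul]
    · intro u v hu hv
      rw [TensorProduct.tmul_add, hu, hv, add_zero]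
  obtain ⟨i⟩ := homology_of_d_zero C hC p
  let j : ((Tor (ModuleCat S) p).obj Z).obj M ≅ C.X p :=
    P.isoLeftDerivedObj F p ≪≫ i
  obtain ⟨e⟩ := hK p
  let k : (Z ⊗[S] K p) ≃ₗ[S] (Fin (m.choose p) → Z) :=
    (LinearEquiv.lTensor Z e).trans (TensorProduct.piScalarRight S S Z _)
  let l : C.X p ≃+ (Fin (m.choose p) → Z) := k.toAddEquiv
  exact ⟨j.toLinearEquiv.toAddEquiv.trans l⟩

end TorPart

theorem tor_base_change_int_free_of_rank_choose
    (n p : ℕ) {S : Type} [CommRing S] (φ : MvPolynomial (Fin n) ℤ →+* S) (ε : S →+* ℤ) :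
    letI : Algebra (MvPolynomial (Fin n) ℤ) S := φ.toAlgebra
    ∀ _ : Module.Free (MvPolynomial (Fin n) ℤ) S,
      Nonempty
        ((((Tor (ModuleCat S) p).obj
              ((ModuleCat.restrictScalars ε).obj (ModuleCat.of ℤ ℤ))).obj
            (ModuleCat.of S
              (TensorProduct (MvPolynomial (Fin n) ℤ) S
                ((ModuleCat.restrictScalars (ε.comp φ)).obj (ModuleCat.of ℤ ℤ))))) ≃+
          (Fin (n.choose p) → ℤ)) := by
  letI : Algebra (MvPolynomial (Fin n) ℤ) S := φ.toAlgebra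
  intro _
  apply HasKos.tor ε
  let ψ : MvPolynomial (Fin n) ℤ →+* ℤ := ε.comp φ
  let N := (ModuleCat.restrictScalars ψ).obj (ModuleCat.of ℤ ℤ)
  suffices h : HasKos (RingHom.ker ψ) n N from
    h.baseChange (S := S) (I := RingHom.ker ψ) (J := RingHom.ker ε) (fun r hr => hr)
  have h1 := HasKos.list (RingHom.ker ψ)
    (List.ofFn fun i => (MvPolynomial.X i - MvPolynomial.C (ψ (MvPolynomial.X i)) :
      MvPolynomial (Fin n) ℤ)) 0 _ (HasKos.base _) (isWeaklyRegular_X_sub_C n _) (by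
        intro r hr
        rw [ker_eq_ofList]
        exact Ideal.subset_span hr)
  rw [← ker_eq_ofList, List.length_ofFn, zero_add] at h1
  let f : MvPolynomial (Fin n) ℤ →ₗ[MvPolynomial (Fin n) ℤ] N :=
    LinearMap.toSpanSingleton _ N (1 : ℤ)
  have hf : ∀ x, f x = ψ x := fun x => mul_one (ψ x)
  have hker : RingHom.ker ψ • (⊤ : Submodule (MvPolynomial (Fin n) ℤ) (MvPolynomial (Fin n) ℤ))
      = LinearMap.ker f := by
    ext x
    simp only [smul_eq_mul, Ideal.mul_top, RingHom.mem_ker, LinearMap.mem_ker, hf]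
    rfl
  have hsurj : Function.Surjective f := fun z =>
    ⟨MvPolynomial.C (show ℤ from z), (hf _).trans <|
      RingHom.congr_fun (RingHom.ext_int (ψ.comp MvPolynomial.C) (RingHom.id ℤ)) z⟩
  exact h1.congr ((Submodule.quotEquivOfEq _ _ hker).trans (f.quotKerEquivOfSurjective hsurj))
end

section
/- Let n be a natural number, let S = ℤ[t₁^{±1},…,tₙ^{±1}] be the Laurent polynomial ring over ℤ in n variables (the group ring over ℤ of the free abelian group of rank n), and let ε : S → ℤ be the augmentation homomorphism sending each tᵢ to 1, making ℤ an S-module. Then for every S-module M and every 0 ≤ p ≤ n there is an isomorphism of abelian groups Ext^p_S(ℤ, M) ≅ Tor_{n−p}^S(ℤ, M). -/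
open CategoryTheory

theorem exists_addEquiv_of_ker {A B C : Type*} [AddCommGroup A] [AddCommGroup B] [AddCommGroup C]
    (a : A →+ B) (b : A →+ C) (ha : Function.Surjective a) (hb : Function.Surjective b)
    (h : ∀ x, a x = 0 ↔ b x = 0) : ∃ e : B ≃+ C, ∀ x, e (a x) = b x := by
  have hk : a.ker = b.ker := by
    ext x; simpa [AddMonoidHom.mem_ker] using h x
  refine ⟨(QuotientAddGroup.quotientKerEquivOfSurjective a ha).symm.trans
    ((QuotientAddGroup.quotientAddEquivOfEq hk).trans
      (QuotientAddGroup.quotientKerEquivOfSurjective b hb)), fun x => ?_⟩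
  have : (QuotientAddGroup.quotientKerEquivOfSurjective a ha).symm (a x)
      = (QuotientAddGroup.mk x : A ⧸ a.ker) := by
    rw [AddEquiv.symm_apply_eq]; rfl
  simp only [AddEquiv.trans_apply, this]
  rfl

/-- `X` is a module for which `Ext` into modules behaves like `Tor` in complementary degree. -/
structure DualityModule {R : Type} [CommRing R] (X : ModuleCat.{0} R) (d : ℕ) : Prop where
  vanish : ∀ (M : ModuleCat.{0} R) (i : ℕ), d < i → ∀ x : Abelian.Ext X M i, x = 0
  proj : ∀ (P : ModuleCat.{0} R) [Projective P] (i : ℕ), i < d → ∀ x : Abelian.Ext X P i, x = 0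
  iso : ∃ e : ∀ M : ModuleCat.{0} R, TensorProduct R X M ≃+ Abelian.Ext X M d,
    ∀ (M N : ModuleCat.{0} R) (f : M ⟶ N) (t : TensorProduct R X M),
      e N (f.hom.lTensor X t) = (e M t).comp (Abelian.Ext.mk₀ f) (add_zero d)

namespace DualityModule
variable {R : Type} [CommRing R]

theorem step {X Z : ModuleCat.{0} R} {d : ℕ} (h : DualityModule X d) (r : R) (g : X ⟶ Z)
    (w : (r • 𝟙 X) ≫ g = 0) (hS : (ShortComplex.mk (r • 𝟙 X) g w).ShortExact) :
    DualityModule Z (d + 1) := by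
  obtain ⟨hv, hp, e, he⟩ := h
  have hepi : Epi g := hS.epi_g
  have hmono : Mono (r • 𝟙 X) := hS.mono_f
  have hgs : Function.Surjective g.hom := (ModuleCat.epi_iff_surjective g).1 hepi
  have hri : Function.Injective (LinearMap.lsmul R X r) := 
    (ModuleCat.mono_iff_injective (r • 𝟙 X)).1 hmono
  have hex : Function.Exact (LinearMap.lsmul R X r) g.hom :=
    (ShortComplex.ShortExact.moduleCat_exact_iff_function_exact _).1 hS.exact
  have smulmk : ∀ (M : ModuleCat.{0} R) (i : ℕ) (x : Abelian.Ext X M i),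
      (Abelian.Ext.mk₀ (r • 𝟙 X)).comp x (zero_add i) = r • x := by
    intro M i x
    rw [Abelian.Ext.mk₀_smul, Abelian.Ext.smul_comp, Abelian.Ext.mk₀_id_comp]
  have esmul : ∀ (M : ModuleCat.{0} R) (t), e M (r • t) = r • e M t := by
    intro M t
    rw [Abelian.Ext.smul_eq_comp_mk₀, ← he]
    congr 1
    have : (r • 𝟙 M : M ⟶ M).hom = r • LinearMap.id := rfl
    rw [this, LinearMap.lTensor_smul]; simp
  refine ⟨?_, ?_, ?_⟩
  · intro M i hi x
    obtain ⟨j, rfl⟩ : ∃ j, i = 1 + j := ⟨i - 1, by omega⟩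
    obtain ⟨y, rfl⟩ := Abelian.Ext.contravariant_sequence_exact₃ hS M x
      (hv _ _ (by omega) _) (n₀ := j) rfl
    rw [hv _ _ (by omega) y]; simp
  · intro P _ i hi x
    have key : (Abelian.Ext.mk₀ g).comp x (zero_add i) = 0 := by
      rcases (Nat.lt_succ_iff_lt_or_eq.1 hi) with hi | rfl
      · exact hp _ _ hi _
      · set y := (Abelian.Ext.mk₀ g).comp x (zero_add i) with hy
        have hy0 : r • y = 0 := by
          rw [← smulmk, hy, ← Abelian.Ext.comp_assoc (a₁ := 0) (a₂ := 0) (a₁₂ := 0) 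
            (a₂₃ := i) (a := i) _ _ _ rfl (zero_add _) (by simp),
            Abelian.Ext.mk₀_comp_mk₀, w]; simp
        obtain ⟨t, ht⟩ := (e P).surjective y
        rw [← ht, ← esmul] at hy0
        have ht0 : r • t = 0 := (e P).injective (by rw [hy0, map_zero])
        have : Module.Projective R P := (IsProjective.iff_projective _).2 inferInstance
        have hinj := Module.Flat.rTensor_preserves_injective_linearMap (M := P) _ hri
        have : t = 0 := hinj (by
          rw [map_zero]
          rw [← ht0]
          have : LinearMap.lsmul R X r = r • LinearMap.id := rfl
          rw [this, LinearMap.rTensor_smul]; simp)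
        rw [← ht, this, map_zero]
    rcases i with _ | j
    · exact Abelian.Ext.precomp_mk₀_injective_of_epi P g (by
        simpa using key)
    · obtain ⟨y, hy⟩ := Abelian.Ext.contravariant_sequence_exact₃ hS P x key (n₀ := j) (by omega)
      rw [← hy, hp _ _ (by omega) y]; simp
  · have main : ∀ M : ModuleCat.{0} R, ∃ e' : TensorProduct R Z M ≃+ Abelian.Ext Z M (d + 1),
        ∀ t, e' (g.hom.rTensor M t) = hS.extClass.comp (e M t) (add_comm 1 d) := by
      intro M
      refine exists_addEquiv_of_ker (g.hom.rTensor M).toAddMonoidHom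
        ((hS.extClass.precomp M (add_comm 1 d)).comp (e M).toAddMonoidHom) ?_ ?_ ?_
      · exact LinearMap.rTensor_surjective M hgs
      · intro x
        obtain ⟨y, hy⟩ := Abelian.Ext.contravariant_sequence_exact₃ hS M x 
          (hv _ _ (by omega) _) (n₀ := d) (by omega)
        obtain ⟨t, rfl⟩ := (e M).surjective y
        exact ⟨t, hy⟩
      · intro t
        have h1 : g.hom.rTensor M t = 0 ↔ ∃ s, r • s = t := by
          have := rTensor_exact M hex hgs t
          rw [this]
          have : LinearMap.lsmul R X r = r • LinearMap.id := rfl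
          rw [this, LinearMap.rTensor_smul]; simp
        have h2 : hS.extClass.comp (e M t) (add_comm 1 d) = 0 ↔ ∃ s, r • s = t := by
          constructor
          · intro h0
            obtain ⟨y, hy⟩ := Abelian.Ext.contravariant_sequence_exact₁ hS M (e M t)
              (add_comm 1 d) h0
            obtain ⟨s, rfl⟩ := (e M).surjective y
            refine ⟨s, (e M).injective ?_⟩
            rw [esmul, ← smulmk]; exact hy
          · rintro ⟨s, rfl⟩
            rw [esmul, ← smulmk]
            exact hS.extClass_comp_assoc (e M s)
        exact h1.trans h2.symm
    choose e' he' using main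
    refine ⟨e', fun M N f t => ?_⟩
    obtain ⟨s, rfl⟩ := LinearMap.rTensor_surjective M hgs t
    have : (f.hom.lTensor Z) (g.hom.rTensor M s) = g.hom.rTensor N (f.hom.lTensor X s) := by
      rw [← LinearMap.comp_apply, ← LinearMap.comp_apply, LinearMap.lTensor_comp_rTensor,
        LinearMap.rTensor_comp_lTensor]
    rw [this, he', he', he, Abelian.Ext.comp_assoc_of_third_deg_zero]

theorem self : DualityModule (ModuleCat.of R R) 0 := by
  have hpr : Projective (ModuleCat.of R R) := (IsProjective.iff_projective _).1 inferInstance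
  refine ⟨fun M i hi x => ?_, fun P _ i hi => absurd hi (by omega), ?_⟩
  · obtain ⟨j, rfl⟩ : ∃ j, i = j + 1 := ⟨i - 1, by omega⟩
    exact x.eq_zero_of_projective
  · refine ⟨fun M => (TensorProduct.lid R M).toAddEquiv.trans
      ((LinearMap.ringLmapEquivSelf R R M).symm.toAddEquiv.trans
        ((ModuleCat.homAddEquiv (M := ModuleCat.of R R)).symm.trans Abelian.Ext.addEquiv₀.symm)), ?_⟩
    intro M N f t
    have h0 : ∀ (L : ModuleCat.{0} R) (t : TensorProduct R (ModuleCat.of R R) L),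
        ((TensorProduct.lid R L).toAddEquiv.trans
      ((LinearMap.ringLmapEquivSelf R R L).symm.toAddEquiv.trans
        ((ModuleCat.homAddEquiv (M := ModuleCat.of R R)).symm.trans
          Abelian.Ext.addEquiv₀.symm))) t =
        Abelian.Ext.mk₀ (ModuleCat.ofHom ((LinearMap.ringLmapEquivSelf R R L).symm
          (TensorProduct.lid R L t))) := fun _ _ => rfl
    rw [h0, h0, Abelian.Ext.mk₀_comp_mk₀]
    congr 1
    apply ModuleCat.hom_ext
    apply LinearMap.ext_ring
    induction t with
    | zero => simp
    | add x y hx hy => simp only [map_add] at *; simp_all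
    | tmul x y => simp

theorem of_iso {X Y : ModuleCat.{0} R} {d : ℕ} (h : DualityModule X d) (i : X ≅ Y) :
    DualityModule Y d := by
  obtain ⟨hv, hp, e, he⟩ := h
  have key : ∀ (M : ModuleCat.{0} R) (n : ℕ) (x : Abelian.Ext Y M n),
      (Abelian.Ext.mk₀ i.inv).comp ((Abelian.Ext.mk₀ i.hom).comp x (zero_add n)) (zero_add n) = x := by
    intro M n x
    rw [Abelian.Ext.mk₀_comp_mk₀_assoc]; simp
  have key' : ∀ (M : ModuleCat.{0} R) (n : ℕ) (x : Abelian.Ext X M n),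
      (Abelian.Ext.mk₀ i.hom).comp ((Abelian.Ext.mk₀ i.inv).comp x (zero_add n)) (zero_add n) = x := by
    intro M n x
    rw [Abelian.Ext.mk₀_comp_mk₀_assoc]; simp
  refine ⟨fun M n hn x => ?_, fun P _ n hn x => ?_, ?_⟩
  · rw [← key M n x, hv _ _ hn ((Abelian.Ext.mk₀ i.hom).comp x (zero_add n))]; simp
  · rw [← key P n x, hp _ _ hn ((Abelian.Ext.mk₀ i.hom).comp x (zero_add n))]; simp
  · refine ⟨fun M => (TensorProduct.congr i.toLinearEquiv.symm (LinearEquiv.refl R M)).toAddEquiv.trans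
      ((e M).trans
        { toFun := fun x => (Abelian.Ext.mk₀ i.inv).comp x (zero_add d)
          invFun := fun x => (Abelian.Ext.mk₀ i.hom).comp x (zero_add d)
          left_inv := key' M d
          right_inv := key M d
          map_add' := by simp }), fun M N f t => ?_⟩
    change (Abelian.Ext.mk₀ i.inv).comp (e N _) (zero_add d) =
      ((Abelian.Ext.mk₀ i.inv).comp (e M _) (zero_add d)).comp _ _
    rw [Abelian.Ext.comp_assoc_of_third_deg_zero, ← he]
    congr 2
    change (TensorProduct.congr i.toLinearEquiv.symm (LinearEquiv.refl R N)) _ =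
      f.hom.lTensor X ((TensorProduct.congr i.toLinearEquiv.symm (LinearEquiv.refl R M)) t)
    induction t with
    | zero => simp
    | add x y hx hy => simp only [map_add] at *; simp only [hx, hy]; try rfl
    | tmul x y => simp

end DualityModule

theorem homology_equiv {R : Type} [Ring R] (S : ShortComplex (ModuleCat.{0} R)) {A : Type}
    [AddCommGroup A] (b : LinearMap.ker S.g.hom →+ A) (hb : Function.Surjective b)
    (h : ∀ x, b x = 0 ↔ ∃ y, S.f.hom y = x.1) : Nonempty (S.homology ≃+ A) := by
  obtain ⟨e, -⟩ := exists_addEquiv_of_ker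
    (LinearMap.range S.moduleCatToCycles).mkQ.toAddMonoidHom b 
    (Submodule.mkQ_surjective _) hb (fun x => by
      rw [h]
      change (LinearMap.range S.moduleCatToCycles).mkQ x = 0 ↔ _
      rw [Submodule.mkQ_apply, Submodule.Quotient.mk_eq_zero]
      constructor
      · rintro ⟨y, rfl⟩; exact ⟨y, rfl⟩
      · rintro ⟨y, hy⟩; exact ⟨y, Subtype.ext hy⟩)
  exact ⟨S.moduleCatHomologyIso.toLinearEquiv.toAddEquiv.trans e⟩

theorem homology_equiv_of {R : Type} [Ring R] (S : ShortComplex (ModuleCat.{0} R)) {A E : Type}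
    [AddCommGroup A] [AddCommGroup E] (φ : S.X₂ →+ E) (δ : A →+ E) (hδ : Function.Injective δ)
    (hφ : Function.Surjective φ) (h1 : ∀ t, S.g.hom t = 0 ↔ φ t ∈ δ.range)
    (h2 : ∀ t, φ t = 0 ↔ ∃ y, S.f.hom y = t) : Nonempty (S.homology ≃+ A) := by
  let b0 : LinearMap.ker S.g.hom →+ δ.range :=
    (φ.comp (LinearMap.ker S.g.hom).subtype.toAddMonoidHom).codRestrict δ.range
      (fun t => (h1 t.1).1 t.2)
  refine homology_equiv _ ((AddMonoidHom.ofInjective hδ).symm.toAddMonoidHom.comp b0) ?_ ?_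
  · refine (AddMonoidHom.ofInjective hδ).symm.surjective.comp ?_
    rintro ⟨y, hy⟩
    obtain ⟨t, rfl⟩ := hφ y
    exact ⟨⟨t, (h1 t).2 hy⟩, rfl⟩
  · intro x
    refine Iff.trans ?_ (h2 x.1)
    change (AddMonoidHom.ofInjective hδ).symm (b0 x) = 0 ↔ _
    rw [AddEquiv.map_eq_zero_iff, Subtype.ext_iff]
    rfl

theorem ext_compare {R : Type} [CommRing R] (X M : ModuleCat.{0} R) (p : ℕ) :
    Nonempty ((((Ext ℤ (ModuleCat.{0} R) p).obj (Opposite.op X)).obj M) ≃+ Abelian.Ext X M p) := by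
  let P := projectiveResolution X
  suffices hs : Nonempty ((P.complex.linearYonedaObj ℤ M).homology p ≃+ Abelian.Ext X M p) by
    obtain ⟨e⟩ := hs
    exact ⟨(P.isoExt p M).toLinearEquiv.toAddEquiv.trans e⟩
  rcases p with _ | p
  · suffices hs : Nonempty (((P.complex.linearYonedaObj ℤ M).sc' 0 0 1).homology ≃+
        Abelian.Ext X M 0) by
      obtain ⟨e⟩ := hs
      exact ⟨(ShortComplex.homologyMapIso ((P.complex.linearYonedaObj ℤ M).isoSc' 0 0 1 (by simp)
        (by simp))).toLinearEquiv.toAddEquiv.trans e⟩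
    obtain ⟨π0, hd, hepi, hexact⟩ : ∃ (π0 : P.complex.X 0 ⟶ X) (hd : P.complex.d 1 0 ≫ π0 = 0),
        Epi π0 ∧ (ShortComplex.mk (P.complex.d 1 0) π0 hd).Exact :=
      ⟨P.π.f 0, P.complex_d_comp_π_f_zero, inferInstanceAs (Epi (P.π.f 0)), P.exact₀⟩
    let b : (X ⟶ M) →+ LinearMap.ker ((P.complex.linearYonedaObj ℤ M).sc' 0 0 1).g.hom :=
      { toFun := fun u => ⟨π0 ≫ u, by
          change P.complex.d 1 0 ≫ (π0 ≫ u) = 0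
          rw [← Category.assoc, hd, Limits.zero_comp]⟩
        map_zero' := Subtype.ext Limits.comp_zero
        map_add' := fun u v => Subtype.ext (Preadditive.comp_add _ _ _ _ _ _) }
    have hb : Function.Bijective b := by
      constructor
      · intro u v h
        have : π0 ≫ u = π0 ≫ v := congrArg Subtype.val h
        exact (cancel_epi _).1 this
      · rintro ⟨f, hf⟩
        have hf' : P.complex.d 1 0 ≫ f = 0 := hf
        refine ⟨hexact.desc f hf', Subtype.ext (hexact.g_desc f hf')⟩
    refine homology_equiv _ (Abelian.Ext.addEquiv₀.symm.toAddMonoidHom.comp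
      (AddEquiv.ofBijective b hb).symm.toAddMonoidHom) ?_ ?_
    · exact (Abelian.Ext.addEquiv₀.symm.surjective).comp (AddEquiv.ofBijective b hb).symm.surjective
    · intro x
      constructor
      · intro h
        have : x = 0 := by simpa using h
        exact ⟨0, by rw [this]; exact map_zero _⟩
      · rintro ⟨y, hy⟩
        have h0 : P.complex.d 0 0 ≫ (y : P.complex.X 0 ⟶ M) = x.1 := hy
        have h1 : P.complex.d 0 0 ≫ (y : P.complex.X 0 ⟶ M) = 0 := by
          rw [P.complex.shape _ _ (by simp)]; exact Limits.zero_comp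
        have : x = 0 := Subtype.ext (h0.symm.trans h1)
        rw [this]; exact map_zero _
  · suffices hs : Nonempty (((P.complex.linearYonedaObj ℤ M).sc' p (p + 1) (p + 2)).homology ≃+
        Abelian.Ext X M (p + 1)) by
      obtain ⟨e⟩ := hs
      exact ⟨(ShortComplex.homologyMapIso ((P.complex.linearYonedaObj ℤ M).isoSc' p (p + 1) (p + 2)
        (by simp) (by simp))).toLinearEquiv.toAddEquiv.trans e⟩
    refine homology_equiv _
      { toFun := fun x => P.extMk (n := p + 1) (x.1 : P.complex.X (p + 1) ⟶ M) (p + 2) rfl x.2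
        map_zero' := P.extMk_zero _ _
        map_add' := fun x y => (P.add_extMk _ _ _ _ _ _).symm } ?_ ?_
    · intro α
      obtain ⟨f, hf, rfl⟩ := P.extMk_surjective α (p + 2) rfl
      exact ⟨⟨f, hf⟩, rfl⟩
    · intro x
      exact P.extMk_eq_zero_iff _ _ rfl x.2 p rfl

theorem tor_aux {R : Type} [CommRing R] {X : ModuleCat.{0} R} {d : ℕ} (h : DualityModule X d)
    (K : ChainComplex (ModuleCat.{0} R) ℕ) (hproj : ∀ i, Projective (K.X i))
    (hex : ∀ i, Function.Exact (K.d (i + 2) (i + 1)).hom (K.d (i + 1) i).hom) (j : ℕ) :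
    ∀ (i : ℕ) (L : ModuleCat.{0} R) (q : K.X i ⟶ L) (_ : Function.Surjective q.hom)
      (_ : Function.Exact (K.d (i + 1) i).hom q.hom) (k : ℕ), k + (j + 1) = d →
    Nonempty (((((MonoidalCategory.tensoringLeft (ModuleCat.{0} R)).obj X).mapHomologicalComplex
      _).obj K).homology (i + (j + 1)) ≃+ Abelian.Ext X L k) := by
  induction j with
  | zero => 
    intro i L q hq hqe k hk
    obtain rfl : k + 1 = d := hk
    obtain ⟨hv, hp, e, he⟩ := h
    let L' : ModuleCat.{0} R := ModuleCat.of R (LinearMap.range (K.d (i + 1) i).hom)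
    let ι : L' ⟶ K.X i := ModuleCat.ofHom (Submodule.subtype _)
    let q' : K.X (i + 1) ⟶ L' := ModuleCat.ofHom (LinearMap.rangeRestrict _)
    have hw : ι ≫ q = 0 := by
      ext ⟨x, hx⟩; exact (hqe x).2 hx
    have hS : (ShortComplex.mk ι q hw).ShortExact := by
      refine ModuleCat.shortComplex_shortExact _ ?_ (Subtype.val_injective) hq
      intro x; rw [hqe x]
      change _ ↔ x ∈ Set.range (Subtype.val : LinearMap.range (K.d (i + 1) i).hom → _)
      simp
    have hqι : q' ≫ ι = K.d (i + 1) i := rfl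
    have hqs2 : Function.Surjective q'.hom := LinearMap.surjective_rangeRestrict _
    have hqe2 : Function.Exact (K.d (i + 2) (i + 1)).hom q'.hom := by
      intro x
      rw [← hex i x]
      exact Subtype.ext_iff
    let δ : Abelian.Ext X L k →+ Abelian.Ext X L' (k + 1) := hS.extClass.postcomp X rfl
    have hδ : Function.Injective δ := by
      rw [injective_iff_map_eq_zero]
      intro x hx
      obtain ⟨y, rfl⟩ := Abelian.Ext.covariant_sequence_exact₃ X hS x rfl hx
      rw [hp _ _ (by omega) y]; simp
    let S := ((((MonoidalCategory.tensoringLeft (ModuleCat.{0} R)).obj X).mapHomologicalComplex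
      (ComplexShape.down ℕ)).obj K)
    suffices hs : Nonempty ((S.sc' (i + 2) (i + 1) i).homology ≃+ Abelian.Ext X L k) by
      obtain ⟨e⟩ := hs
      exact ⟨(ShortComplex.homologyMapIso (S.isoSc' (i + 2) (i + 1) i
        (by simp) (by simp))).toLinearEquiv.toAddEquiv.trans e⟩
    have hf : (S.sc' (i + 2) (i + 1) i).f.hom = (K.d (i + 2) (i + 1)).hom.lTensor X := rfl
    have hg : (S.sc' (i + 2) (i + 1) i).g.hom = (K.d (i + 1) i).hom.lTensor X := rfl
    have hrange : ∀ t : TensorProduct R X (K.X (i + 1)), 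
        ((K.d (i + 1) i).hom.lTensor X t = 0 ↔ e L' (q'.hom.lTensor X t) ∈ δ.range) := by
      intro t
      have h1 : (e L' (q'.hom.lTensor X t)).comp (Abelian.Ext.mk₀ ι) (add_zero _) = 
          e _ ((K.d (i + 1) i).hom.lTensor X t) := by
        rw [← he, ← hqι, ModuleCat.hom_comp, LinearMap.lTensor_comp]; rfl
      constructor
      · intro h0
        rw [h0, map_zero] at h1
        obtain ⟨y, hy⟩ := Abelian.Ext.covariant_sequence_exact₁ X hS _ h1 rfl
        exact ⟨y, hy⟩
      · rintro ⟨y, hy⟩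
        have : (e L' (q'.hom.lTensor X t)).comp (Abelian.Ext.mk₀ ι) (add_zero _) = 0 := by
          rw [← hy]
          change (y.comp hS.extClass rfl).comp (Abelian.Ext.mk₀ ι) (add_zero _) = 0
          rw [Abelian.Ext.comp_assoc_of_third_deg_zero, hS.extClass_comp, Abelian.Ext.comp_zero]
        exact (e _).injective (by rw [← h1, this, map_zero])
    refine homology_equiv_of (S.sc' (i + 2) (i + 1) i)
      ((e L').toAddMonoidHom.comp (q'.hom.lTensor X).toAddMonoidHom) δ hδ ?_ hrange ?_
    · exact (e L').surjective.comp (LinearMap.lTensor_surjective X hqs2)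
    · intro t
      refine Iff.trans ?_ (lTensor_exact X hqe2 hqs2 t)
      exact AddEquiv.map_eq_zero_iff (e L')
  | succ j ih =>
    intro i L q hq hqe k hk
    let L' : ModuleCat.{0} R := ModuleCat.of R (LinearMap.range (K.d (i + 1) i).hom)
    let ι : L' ⟶ K.X i := ModuleCat.ofHom (Submodule.subtype _)
    let q' : K.X (i + 1) ⟶ L' := ModuleCat.ofHom (LinearMap.rangeRestrict _)
    have hw : ι ≫ q = 0 := by
      ext ⟨x, hx⟩; exact (hqe x).2 hx
    have hS : (ShortComplex.mk ι q hw).ShortExact := by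
      refine ModuleCat.shortComplex_shortExact _ ?_ (Subtype.val_injective) hq
      intro x; rw [hqe x]
      change _ ↔ x ∈ Set.range (Subtype.val : LinearMap.range (K.d (i + 1) i).hom → _)
      simp
    have hqs2 : Function.Surjective q'.hom := LinearMap.surjective_rangeRestrict _
    have hqe2 : Function.Exact (K.d (i + 2) (i + 1)).hom q'.hom := by
      intro x
      rw [← hex i x]
      exact Subtype.ext_iff
    obtain ⟨e1⟩ := ih (i + 1) L' q' hqs2 hqe2 (k + 1) (by omega)
    let δ : Abelian.Ext X L k →+ Abelian.Ext X L' (k + 1) := hS.extClass.postcomp X rfl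
    have hδ : Function.Bijective δ := by
      constructor
      · rw [injective_iff_map_eq_zero]
        intro x hx
        obtain ⟨y, rfl⟩ := Abelian.Ext.covariant_sequence_exact₃ X hS x rfl hx
        rw [h.proj _ _ (by omega) y]; simp
      · intro y
        exact Abelian.Ext.covariant_sequence_exact₁ X hS y (h.proj _ _ (by omega) _) rfl
    rw [show i + (j + 1 + 1) = i + 1 + (j + 1) by omega]
    exact ⟨e1.trans (AddEquiv.ofBijective δ hδ).symm⟩

theorem tor_iso {R : Type} [CommRing R] {X : ModuleCat.{0} R} {d : ℕ} (h : DualityModule X d)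
    (M : ModuleCat.{0} R) (p : ℕ) (hp : p ≤ d) :
    Nonempty ((((Tor (ModuleCat.{0} R) (d - p)).obj X).obj M) ≃+ Abelian.Ext X M p) := by
  let P := projectiveResolution M
  let S := ((((MonoidalCategory.tensoringLeft (ModuleCat.{0} R)).obj X).mapHomologicalComplex
      (ComplexShape.down ℕ)).obj P.complex)
  suffices hs : Nonempty (S.homology (d - p) ≃+ Abelian.Ext X M p) by
    obtain ⟨e⟩ := hs
    exact ⟨(P.isoLeftDerivedObj ((MonoidalCategory.tensoringLeft (ModuleCat.{0} R)).obj X)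
      (d - p)).toLinearEquiv.toAddEquiv.trans e⟩
  have hq : Function.Surjective (P.π.f 0).hom := (ModuleCat.epi_iff_surjective _).1 inferInstance
  have hqe : Function.Exact (P.complex.d 1 0).hom (P.π.f 0).hom :=
    (ShortComplex.ShortExact.moduleCat_exact_iff_function_exact _).1 P.exact₀
  have hex : ∀ i, Function.Exact (P.complex.d (i + 2) (i + 1)).hom (P.complex.d (i + 1) i).hom :=
    fun i => (ShortComplex.ShortExact.moduleCat_exact_iff_function_exact _).1 (P.exact_succ i)
  rcases Nat.lt_or_ge p d with hlt | hge
  · obtain ⟨j, rfl⟩ : ∃ j, d = p + (j + 1) := ⟨d - p - 1, by omega⟩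
    have := tor_aux h P.complex (fun i => inferInstance) hex j 0 M (P.π.f 0) hq hqe p rfl
    rw [show p + (j + 1) - p = 0 + (j + 1) by omega]
    exact this
  · obtain rfl : p = d := le_antisymm hp hge
    obtain ⟨hv, hp', e, he⟩ := h
    rw [Nat.sub_self]
    suffices hs : Nonempty ((S.sc' 1 0 0).homology ≃+ Abelian.Ext X M p) by
      obtain ⟨e⟩ := hs
      exact ⟨(ShortComplex.homologyMapIso (S.isoSc' 1 0 0
        (by simp) (by simp))).toLinearEquiv.toAddEquiv.trans e⟩
    have hg : (S.sc' 1 0 0).g = 0 := S.shape _ _ (by simp)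
    refine homology_equiv_of (S.sc' 1 0 0)
      ((e M).toAddMonoidHom.comp ((P.π.f 0).hom.lTensor X).toAddMonoidHom) (AddMonoidHom.id _)
      Function.injective_id ?_ ?_ ?_
    · exact (e M).surjective.comp (LinearMap.lTensor_surjective X hq)
    · intro t
      rw [hg]
      exact ⟨fun _ => ⟨_, rfl⟩, fun _ => rfl⟩
    · intro t
      refine Iff.trans ?_ (lTensor_exact X hqe hq t)
      exact AddEquiv.map_eq_zero_iff (e M)


/-- Laurent polynomials. -/
abbrev LaurentZ (m : ℕ) := AddMonoidAlgebra ℤ (Fin m → ℤ)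

/-- Forget the first variable, i.e. set it to one. -/
noncomputable def laurentTail (m : ℕ) : LaurentZ (m + 1) →+* LaurentZ m :=
  AddMonoidAlgebra.mapDomainRingHom ℤ 
    ({ toFun := Fin.tail, map_zero' := rfl, map_add' := fun _ _ => rfl } : (Fin (m + 1) → ℤ) →+ (Fin m → ℤ))

theorem laurentTail_single (m : ℕ) (g : Fin (m + 1) → ℤ) (c : ℤ) :
    laurentTail m (AddMonoidAlgebra.single g c) = AddMonoidAlgebra.single (Fin.tail g) c := by
  simp [laurentTail]; rfl

/-- The element `t₀ - 1`. -/
noncomputable def laurentX (m : ℕ) : LaurentZ (m + 1) :=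
  AddMonoidAlgebra.single (Fin.cons 1 0) 1 - 1

theorem laurentX_ne (m : ℕ) : laurentX m ≠ 0 := by
  intro h
  rw [laurentX, sub_eq_zero, AddMonoidAlgebra.one_def] at h
  have := AddMonoidAlgebra.single_left_injective (R := ℤ) (one_ne_zero) h
  have := congrFun this 0
  simp at this

theorem laurentX_tail (m : ℕ) : laurentTail m (laurentX m) = 0 := by
  rw [laurentX, map_sub, laurentTail_single, map_one, AddMonoidAlgebra.one_def]
  simp [Fin.tail_cons]

/-- Section. -/
noncomputable def laurentSec (m : ℕ) : LaurentZ m →+* LaurentZ (m + 1) :=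
  AddMonoidAlgebra.mapDomainRingHom ℤ 
    ({ toFun := fun g => Fin.cons 0 g, map_zero' := by ext i; refine Fin.cases ?_ ?_ i <;> simp, 
       map_add' := fun _ _ => by ext i; refine Fin.cases ?_ ?_ i <;> simp } : (Fin m → ℤ) →+ (Fin (m+1) → ℤ))

theorem laurentSec_single (m : ℕ) (g : Fin m → ℤ) (c : ℤ) :
    laurentSec m (AddMonoidAlgebra.single g c) = AddMonoidAlgebra.single (Fin.cons 0 g) c := by
  simp [laurentSec]

theorem laurentTail_sec (m : ℕ) (a : LaurentZ m) : laurentTail m (laurentSec m a) = a := by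
  induction a using AddMonoidAlgebra.induction_linear with
  | zero => simp
  | add f g hf hg => simp [hf, hg]
  | single g c => rw [laurentSec_single, laurentTail_single]; simp

theorem laurent_sub_mem (m : ℕ) (a : LaurentZ (m + 1)) :
    a - laurentSec m (laurentTail m a) ∈ Ideal.span {laurentX m} := by
  rw [← Ideal.Quotient.eq]
  induction a using AddMonoidAlgebra.induction_linear with
  | zero => simp
  | add f g hf hg => simp only [map_add, hf, hg]
  | single g c =>
    rw [laurentTail_single, laurentSec_single]
    have h1 : AddMonoidAlgebra.single g c = 
        (AddMonoidAlgebra.single (Fin.cons 0 (Fin.tail g)) c : LaurentZ (m + 1)) * 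
        AddMonoidAlgebra.of ℤ _ (Multiplicative.ofAdd (Fin.cons 1 0) ^ (g 0)) := by
      rw [← ofAdd_zsmul, AddMonoidAlgebra.of_apply, AddMonoidAlgebra.single_mul_single, mul_one]
      congr 1
      ext i; refine Fin.cases ?_ ?_ i <;> simp [Fin.tail]
    have h2 : ∀ k : ℤ, ((Ideal.Quotient.mk (Ideal.span {laurentX m})).toMonoidHom.comp
        (AddMonoidAlgebra.of ℤ (Fin (m + 1) → ℤ))) (Multiplicative.ofAdd (Fin.cons 1 0) ^ k) = 1 := by
      intro k
      have h3 : ((Ideal.Quotient.mk (Ideal.span {laurentX m})).toMonoidHom.comp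
        (AddMonoidAlgebra.of ℤ (Fin (m + 1) → ℤ))) (Multiplicative.ofAdd (Fin.cons 1 0)) = 1 := by
        change Ideal.Quotient.mk (Ideal.span {laurentX m}) _ = Ideal.Quotient.mk _ 1
        rw [Ideal.Quotient.eq]
        exact Ideal.subset_span rfl
      rw [← MonoidHom.mem_ker] at h3 ⊢
      exact Subgroup.zpow_mem _ h3 k
    rw [h1, map_mul]
    erw [h2 (g 0)]
    rw [mul_one]

theorem laurentTail_eq_zero (m : ℕ) (a : LaurentZ (m + 1)) (h : laurentTail m a = 0) : 
    ∃ b, laurentX m * b = a := by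
  have := laurent_sub_mem m a
  rw [h, map_zero, sub_zero, Ideal.mem_span_singleton] at this
  obtain ⟨b, rfl⟩ := this
  exact ⟨b, rfl⟩

theorem laurent_hom_ext {m : ℕ} (f g : LaurentZ m →+* ℤ)
    (hf : ∀ v : Fin m → ℤ, f (AddMonoidAlgebra.single v 1) = 1) 
    (hg : ∀ v : Fin m → ℤ, g (AddMonoidAlgebra.single v 1) = 1) : f = g := by
  apply AddMonoidAlgebra.ringHom_ext
  · intro r; exact DFunLike.congr_fun (RingHom.ext_int (f.comp AddMonoidAlgebra.singleZeroRingHom)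
       (g.comp AddMonoidAlgebra.singleZeroRingHom)) r
  · intro v; rw [hf, hg]


/-- A ring homomorphism, as a linear map over a ring mapping to its source. -/
noncomputable def ringHomMap {R A B : Type} [CommRing R] [CommRing A] [CommRing B]
    (f : R →+* A) (φ : A →+* B) :
    (ModuleCat.restrictScalars f).obj (ModuleCat.of A A) ⟶
      (ModuleCat.restrictScalars (φ.comp f)).obj (ModuleCat.of B B) :=
  ModuleCat.ofHom (X := (ModuleCat.restrictScalars f).obj (ModuleCat.of A A))
    (Y := (ModuleCat.restrictScalars (φ.comp f)).obj (ModuleCat.of B B))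
    { toFun := φ
      map_add' := φ.map_add
      map_smul' := fun r x => φ.map_mul (f r) x }

theorem laurent_duality {R : Type} [CommRing R] (m : ℕ) :
    ∀ (d : ℕ) (f : R →+* LaurentZ m) (_ : Function.Surjective f)
      (_ : DualityModule ((ModuleCat.restrictScalars f).obj
        (ModuleCat.of (LaurentZ m) (LaurentZ m))) d)
      (ε : LaurentZ m →+* ℤ) (_ : ∀ g : Fin m → ℤ, ε (AddMonoidAlgebra.single g 1) = 1),
      DualityModule ((ModuleCat.restrictScalars (ε.comp f)).obj (ModuleCat.of ℤ ℤ)) (d + m) := by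
  induction m with
  | zero =>
    intro d f hf h ε hε
    have hbij : Function.Bijective (ringHomMap f ε) := by
      constructor
      · refine (injective_iff_map_eq_zero ε).2 (fun a ha => ?_)
        have hs : ∀ a : LaurentZ 0, a = algebraMap ℤ (LaurentZ 0) (ε a) := by
          intro a
          induction a using AddMonoidAlgebra.induction_linear with
          | zero => simp
          | add x y hx hy => rw [map_add, map_add, ← hx, ← hy]
          | single g c =>
            have h1 : (AddMonoidAlgebra.single g c : LaurentZ 0) = algebraMap ℤ (LaurentZ 0) c := by
              rw [Subsingleton.elim g 0]; rfl
            rw [h1]; simp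
        rw [hs a, ha, map_zero]
      · intro c
        exact ⟨algebraMap ℤ (LaurentZ 0) c, by
          exact RingHom.congr_fun (RingHom.ext_int (ε.comp (algebraMap ℤ (LaurentZ 0)))
            (RingHom.id ℤ)) c⟩
    have : IsIso (ringHomMap f ε) := by
      rw [ConcreteCategory.isIso_iff_bijective]; exact hbij
    exact h.of_iso (asIso (ringHomMap f ε))
  | succ m ih =>
    intro d f hf h ε hε
    obtain ⟨r, hr⟩ := hf (laurentX m)
    have hfs : Function.Surjective ((laurentTail m).comp f) :=
      Function.Surjective.comp (g := laurentTail m) (fun a => ⟨_, laurentTail_sec m a⟩) hf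
    have hsm : ∀ x : LaurentZ (m + 1), (ModuleCat.Hom.hom (r • 𝟙 ((ModuleCat.restrictScalars f).obj
        (ModuleCat.of (LaurentZ (m + 1)) (LaurentZ (m + 1)))))) x = laurentX m * x := by
      intro x
      change f r * x = _
      rw [hr]
    have w : (r • 𝟙 ((ModuleCat.restrictScalars f).obj
        (ModuleCat.of (LaurentZ (m + 1)) (LaurentZ (m + 1))))) ≫ ringHomMap f (laurentTail m) = 0 := by
      apply ModuleCat.hom_ext
      apply LinearMap.ext
      intro (x : LaurentZ (m + 1))
      change laurentTail m (f r * x) = 0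
      rw [map_mul, hr, laurentX_tail, zero_mul]
    have h' : DualityModule ((ModuleCat.restrictScalars ((laurentTail m).comp f)).obj
        (ModuleCat.of (LaurentZ m) (LaurentZ m))) (d + 1) := by
      refine h.step r (ringHomMap f (laurentTail m)) w
        (ModuleCat.shortComplex_shortExact _ ?_ ?_ ?_)
      · intro x
        constructor
        · intro hx
          obtain ⟨b, hb⟩ := laurentTail_eq_zero m x hx
          exact ⟨b, (hsm b).trans hb⟩
        · rintro ⟨b, rfl⟩
          exact congrArg (fun u => ModuleCat.Hom.hom u b) w
      · intro (x : LaurentZ (m + 1)) (y : LaurentZ (m + 1)) hxy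
        have h1 : laurentX m * x = laurentX m * y := (hsm x).symm.trans (hxy.trans (hsm y))
        have h3 : x = y := mul_left_cancel₀ (laurentX_ne m) h1
        exact h3
      · exact fun a => ⟨laurentSec m a, laurentTail_sec m a⟩
    have hε' : ∀ g : Fin m → ℤ, (ε.comp (laurentSec m)) (AddMonoidAlgebra.single g 1) = 1 := by
      intro g
      rw [RingHom.comp_apply, laurentSec_single, hε]
    have hcomp : (ε.comp (laurentSec m)).comp (laurentTail m) = ε := by
      refine laurent_hom_ext _ _ (fun v => ?_) hε
      rw [RingHom.comp_apply, laurentTail_single, hε']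
    have h2 := ih (d + 1) ((laurentTail m).comp f) hfs h' (ε.comp (laurentSec m)) hε'
    rw [← RingHom.comp_assoc, hcomp] at h2
    rw [show d + (m + 1) = d + 1 + m by omega]
    exact h2

/-- Module-theoretic Poincaré duality for `ℤⁿ`: for `S = ℤ[t₁^±,…,tₙ^±]` the group ring of the
free abelian group `ℤⁿ` with augmentation `ε` sending each group element to `1` (making `ℤ` an
`S`-module), for every `S`-module `M` and `0 ≤ p ≤ n` there is an isomorphism of abelian groups
`Ext^p_S(ℤ, M) ≅ Tor_{n-p}^S(ℤ, M)`. -/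
theorem ext_iso_tor_laurent
    (n p : ℕ) (hp : p ≤ n)
    (ε : AddMonoidAlgebra ℤ (Fin n → ℤ) →+* ℤ)
    (hε : ∀ g : Fin n → ℤ, ε (AddMonoidAlgebra.single g 1) = 1)
    (M : ModuleCat (AddMonoidAlgebra ℤ (Fin n → ℤ))) :
    Nonempty
      ((((Ext ℤ (ModuleCat (AddMonoidAlgebra ℤ (Fin n → ℤ))) p).obj
            (Opposite.op ((ModuleCat.restrictScalars ε).obj (ModuleCat.of ℤ ℤ)))).obj M) ≃+
        (((Tor (ModuleCat (AddMonoidAlgebra ℤ (Fin n → ℤ))) (n - p)).obj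
            ((ModuleCat.restrictScalars ε).obj (ModuleCat.of ℤ ℤ))).obj M)) := by
  have h0 : DualityModule ((ModuleCat.restrictScalars (RingHom.id (LaurentZ n))).obj
      (ModuleCat.of (LaurentZ n) (LaurentZ n))) 0 :=
    DualityModule.self.of_iso ((ModuleCat.restrictScalarsId (LaurentZ n)).symm.app _)
  have h := laurent_duality n 0 (RingHom.id _) Function.surjective_id h0 ε hε
  rw [zero_add] at h
  obtain ⟨e1⟩ := ext_compare ((ModuleCat.restrictScalars ε).obj (ModuleCat.of ℤ ℤ)) M p
  obtain ⟨e2⟩ := tor_iso h M p hp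
  exact ⟨e1.trans e2.symm⟩
end

section
/- Let n be a natural number, let S = ℤ[t₁^{±1},…,tₙ^{±1}] be the Laurent polynomial ring over ℤ in n variables, let φ : ℤ[x₁,…,xₙ] → S be a ring homomorphism from the polynomial ring over ℤ in n variables making S a free ℤ[x₁,…,xₙ]-module, and let ε : S → ℤ be the augmentation homomorphism sending each tᵢ to 1, so that ℤ is an S-module via ε and a ℤ[x₁,…,xₙ]-module via ε ∘ φ. Then for every 0 ≤ p ≤ n the abelian group Ext^p_S(ℤ, S ⊗_{ℤ[x₁,…,xₙ]} ℤ) is a free abelian group of rank (n choose p). -/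
open CategoryTheory

namespace ExtLaurent

universe w v u

section comparison

variable {C : Type u} [Category.{v} C] [Abelian C] [HasExt.{w} C] [EnoughProjectives C]
  {A : Type*} [CommRing A] [Linear A C] {X : C} (Y : C) (P : ProjectiveResolution X)

open CochainComplex.HomComplex in
lemma extMk_eq_zero_iff' (n : ℕ) (f : P.complex.X n ⟶ Y) (m : ℕ) (hm : n + 1 = m)
    (hf : P.complex.d m n ≫ f = 0) :
    P.extMk f m hm hf = 0 ↔
      ∃ (g : P.complex.X ((ComplexShape.up ℕ).prev n) ⟶ Y), P.complex.d n _ ≫ g = f := by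
  cases n with
  | succ n =>
    obtain h : (ComplexShape.up ℕ).prev (n+1) = n := by simp
    rw [h]
    exact P.extMk_eq_zero_iff f m hm hf n rfl
  | zero =>
    have hd : P.complex.d 0 ((ComplexShape.up ℕ).prev 0) = 0 := by
      apply P.complex.shape
      simp
    simp only [hd, Limits.zero_comp, exists_const]
    constructor
    · intro h
      simp only [← P.extEquivCohomologyClass.apply_eq_iff_eq,
        ProjectiveResolution.extEquivCohomologyClass_extMk,
        ProjectiveResolution.extEquivCohomologyClass_zero,
        CohomologyClass.mk_eq_zero_iff] at h
      rw [Cocycle.toSingleMk_mem_coboundaries_iff _ _ _ _ _ 1 (by lia)] at h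
      obtain ⟨g, hg⟩ := h
      have hz : Limits.IsZero (P.cochainComplex.X 1) :=
        P.cochainComplex.isZero_of_isStrictlyLE 0 _ (by simp)
      rw [hz.eq_of_src g 0, Limits.comp_zero] at hg
      exact (cancel_epi (P.cochainComplexXIso (-((0 : ℕ) : ℤ)) 0 rfl).hom).1 (by simpa using hg)
    · rintro rfl
      exact P.extMk_zero m hm

noncomputable def oldExtEquiv (n : ℕ) :
    ((Ext A C n).obj (Opposite.op X)).obj Y ≃+ Abelian.Ext.{w} X Y n := by
  let S := (P.complex.linearYonedaObj A Y).sc n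
  have hn : (ComplexShape.up ℕ).next n = n + 1 := by simp
  let e1 : ((Ext A C n).obj (Opposite.op X)).obj Y ≃+ (LinearMap.ker S.g.hom ⧸ LinearMap.range S.moduleCatToCycles) :=
    ((P.isoExt n Y) ≪≫ S.moduleCatHomologyIso).toLinearEquiv.toAddEquiv
  let F : LinearMap.ker S.g.hom →+ Abelian.Ext.{w} X Y n :=
    { toFun := fun f => P.extMk (show P.complex.X n ⟶ Y from f.1) ((ComplexShape.up ℕ).next n) hn.symm
        f.2
      map_zero' := P.extMk_zero _ _
      map_add' := fun f g => (P.add_extMk _ _ _ _ _ _).symm }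
  have hF : Function.Surjective F := by
    intro x
    obtain ⟨f, hf, rfl⟩ := P.extMk_surjective x _ hn.symm
    exact ⟨⟨f, hf⟩, rfl⟩
  have hk : (LinearMap.range S.moduleCatToCycles).toAddSubgroup = F.ker := by
    ext f
    refine Iff.trans ?_ (extMk_eq_zero_iff' Y P n _ _ hn.symm f.2).symm
    constructor
    · rintro ⟨g, rfl⟩
      exact ⟨g, rfl⟩
    · rintro ⟨g, hg⟩
      exact ⟨g, Subtype.ext hg⟩
  exact e1.trans ((QuotientAddGroup.quotientAddEquivOfEq hk).trans
    (QuotientAddGroup.quotientKerEquivOfSurjective F hF))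

end comparison
end ExtLaurent


namespace ExtLaurent
open Abelian RingTheory.Sequence Pointwise
universe v u

variable {R : Type u} [CommRing R] [Small.{v} R]

section
variable (N M : ModuleCat.{v} R) (r : R)

lemma smul_ext_eq_zero (hN : ∀ x : N, r • x = 0) (p : ℕ) (x : Ext N M p) :
    x.comp (Ext.mk₀ (M.smulShortComplex r).f) (add_zero p) = 0 := by
  have h0 : r • 𝟙 N = 0 := by
    ext x
    exact hN x
  rw [ModuleCat.smulShortComplex_f_eq_smul_id]
  erw [← Ext.smul_eq_comp_mk₀]
  rw [← x.mk₀_id_comp, ← Ext.smul_comp, ← Ext.mk₀_smul, h0, Ext.mk₀_zero, Ext.zero_comp]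
  rfl

lemma comp_g_extClass {S : ShortComplex (ModuleCat.{v} R)} (hS : S.ShortExact) (N : ModuleCat.{v} R)
    (p : ℕ) (x : Ext N S.X₂ p) :
    (x.comp (Ext.mk₀ S.g) (add_zero p)).comp hS.extClass (rfl : p + 1 = p + 1) = 0 := by
  rw [Ext.comp_assoc _ _ _ (add_zero p) (zero_add 1) (by omega), hS.comp_extClass]
  apply Ext.comp_zero

/-- short exact sequence, packaged. -/
lemma rees_split (hN : ∀ x : N, r • x = 0) (hr : IsSMulRegular M r) (p a b : ℕ)
    (ha : Nonempty (Ext N M p ≃+ (Fin a → ℤ))) (hb : Nonempty (Ext N M (p+1) ≃+ (Fin b → ℤ))) :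
    Nonempty (Ext N (ModuleCat.of R (QuotSMulTop r M)) p ≃+ (Fin (a + b) → ℤ)) := by
  obtain ⟨ea⟩ := ha
  obtain ⟨eb⟩ := hb
  have hS := hr.smulShortComplex_shortExact
  let f : (Fin a → ℤ) →ₗ[ℤ] Ext N (ModuleCat.of R (QuotSMulTop r M)) p :=
    (((Ext.mk₀ (M.smulShortComplex r).g).postcomp N (add_zero p)).comp
      ea.symm.toAddMonoidHom).toIntLinearMap
  let g : Ext N (ModuleCat.of R (QuotSMulTop r M)) p →ₗ[ℤ] (Fin b → ℤ) :=
    (eb.toAddMonoidHom.comp (hS.extClass.postcomp N (rfl : p + 1 = p + 1))).toIntLinearMap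
  have hf : Function.Injective f := by
    rw [injective_iff_map_eq_zero]
    intro x hx
    obtain ⟨y, hy⟩ := Ext.covariant_sequence_exact₂ N hS (ea.symm x) hx
    have hy' : (0 : Ext N M p) = ea.symm x := (smul_ext_eq_zero N M r hN p y).symm.trans hy
    simpa using hy'.symm
  have hg : Function.Surjective g := by
    intro x
    obtain ⟨y, hy⟩ := Ext.covariant_sequence_exact₁ N hS (eb.symm x)
      (smul_ext_eq_zero N M r hN _ _) rfl
    refine ⟨y, ?_⟩
    change eb (y.comp hS.extClass rfl) = x
    rw [hy]; simp
  have hfg : Function.Exact f g := by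
    intro x
    constructor
    · intro hx
      have hx' : x.comp hS.extClass rfl = 0 := eb.injective (hx.trans (map_zero eb).symm)
      obtain ⟨y, hy⟩ := Ext.covariant_sequence_exact₃ N hS x rfl hx'
      refine ⟨ea y, ?_⟩
      change (ea.symm (ea y)).comp (Ext.mk₀ (M.smulShortComplex r).g) (add_zero p) = x
      exact (congrArg (fun z : Ext N M p => z.comp (Ext.mk₀ (M.smulShortComplex r).g) (add_zero p))
        (ea.symm_apply_apply y)).trans hy
    · rintro ⟨y, rfl⟩
      change eb (((ea.symm y).comp (Ext.mk₀ (M.smulShortComplex r).g) (add_zero p)).comp hS.extClass rfl) = 0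
      have h0 : ((ea.symm y).comp (Ext.mk₀ (M.smulShortComplex r).g) (add_zero p)).comp
          hS.extClass (rfl : p + 1 = p + 1) = 0 := comp_g_extClass hS N p (ea.symm y)
      exact (congrArg eb h0).trans (map_zero eb)
  obtain ⟨s, hs⟩ := Module.projective_lifting_property g LinearMap.id hg
  let e := (hfg.splitSurjectiveEquiv hf ⟨s, hs⟩).1
  exact ⟨(e.toAddEquiv.trans
    (LinearEquiv.sumArrowLequivProdArrow (Fin a) (Fin b) ℤ ℤ).symm.toAddEquiv).trans
    (LinearEquiv.funCongrLeft ℤ ℤ finSumFinEquiv.symm).toAddEquiv⟩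

end

/-- expected rank -/
def rk (n k p : ℕ) : ℕ := if p ≤ n then k.choose (n - p) else 0

lemma rk_succ (n k p : ℕ) : rk n k p + rk n k (p + 1) = rk n (k + 1) p := by
  unfold rk
  rcases lt_trichotomy p n with h | rfl | h
  · obtain ⟨d, rfl⟩ := Nat.exists_eq_add_of_lt h
    rw [if_pos (by omega), if_pos (by omega), if_pos (by omega)]
    rw [show p + d + 1 - p = d + 1 by omega, show p + d + 1 - (p + 1) = d by omega,
      Nat.choose_succ_succ, add_comm]
  · simp
  · simp [show ¬ p ≤ n by omega, show ¬ p + 1 ≤ n by omega]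

lemma extEquivOfLinearEquiv (N : ModuleCat.{v} R) {M M' : Type v} [AddCommGroup M] [Module R M]
    [AddCommGroup M'] [Module R M'] (e : M ≃ₗ[R] M') (p : ℕ) :
    Nonempty (Ext N (ModuleCat.of R M) p ≃+ Ext N (ModuleCat.of R M') p) :=
  ⟨{ toFun := fun x => x.comp (Ext.mk₀ e.toModuleIso.hom) (add_zero p)
     invFun := fun x => x.comp (Ext.mk₀ e.toModuleIso.inv) (add_zero p)
     left_inv := fun x => by
      dsimp only
      rw [Ext.comp_assoc_of_third_deg_zero, Ext.mk₀_comp_mk₀, Iso.hom_inv_id, Ext.comp_mk₀_id]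
     right_inv := fun x => by
      dsimp only
      rw [Ext.comp_assoc_of_third_deg_zero, Ext.mk₀_comp_mk₀, Iso.inv_hom_id, Ext.comp_mk₀_id]
     map_add' := fun x y => by simp }⟩

theorem ext_quot (N : ModuleCat.{v} R) (n : ℕ) (rs : List R) (hN : ∀ r ∈ rs, ∀ x : N, r • x = 0)
    (k : ℕ) (M : Type v) [AddCommGroup M] [Module R M] (hreg : IsWeaklyRegular M rs)
    (hM : ∀ p, Nonempty (Ext N (ModuleCat.of R M) p ≃+ (Fin (rk n k p) → ℤ))) (p : ℕ) :
    Nonempty (Ext N (ModuleCat.of R (M ⧸ (Ideal.ofList rs • ⊤ : Submodule R M))) p ≃+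
      (Fin (rk n (k + rs.length) p) → ℤ)) := by
  induction rs generalizing k M with
  | nil =>
    obtain ⟨e⟩ := hM p
    obtain ⟨e'⟩ := extEquivOfLinearEquiv N
      (Submodule.quotEquivOfEqBot (Ideal.ofList ([] : List R) • ⊤ : Submodule R M) (by simp)) p
    exact ⟨e'.trans e⟩
  | cons r rs ih =>
    rw [isWeaklyRegular_cons_iff] at hreg
    obtain ⟨e⟩ := ih (fun s hs => hN s (List.mem_cons_of_mem _ hs)) (k + 1) (QuotSMulTop r M)
      hreg.2 (fun q => by
        rw [← rk_succ]
        exact rees_split N (ModuleCat.of R M) r (hN r List.mem_cons_self) hreg.1 q _ _ (hM q) (hM (q+1)))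
    obtain ⟨e'⟩ := extEquivOfLinearEquiv N
      (Submodule.quotOfListConsSMulTopEquivQuotSMulTopInner M r rs) p
    rw [show k + (r :: rs).length = k + 1 + rs.length by simp; omega]
    exact ⟨e'.trans e⟩

/-- projective dimension bound -/
theorem projdim_quot (rs : List R) (k : ℕ) (M : Type v) [AddCommGroup M] [Module R M]
    (hreg : IsWeaklyRegular M rs) (hM : HasProjectiveDimensionLT (ModuleCat.of R M) k) :
    HasProjectiveDimensionLT (ModuleCat.of R (M ⧸ (Ideal.ofList rs • ⊤ : Submodule R M)))
      (k + rs.length) := by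
  induction rs generalizing k M with
  | nil =>
    exact hasProjectiveDimensionLT_of_iso
      (Submodule.quotEquivOfEqBot (Ideal.ofList ([] : List R) • ⊤ : Submodule R M)
        (by simp)).toModuleIso.symm _
  | cons r rs ih =>
    rw [isWeaklyRegular_cons_iff] at hreg
    have hS := IsSMulRegular.smulShortComplex_shortExact (M := ModuleCat.of R M) hreg.1
    have h1 := ih (k + 1) (QuotSMulTop r M) hreg.2
      (hS.hasProjectiveDimensionLT_X₃ k hM (@hasProjectiveDimensionLT_of_ge _ _ _ (ModuleCat.of R M) k (k+1) (by omega) hM))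
    rw [show k + (r :: rs).length = k + 1 + rs.length by simp; omega]
    exact hasProjectiveDimensionLT_of_iso
      (Submodule.quotOfListConsSMulTopEquivQuotSMulTopInner M r rs).toModuleIso.symm _

/-- Rees: low-degree computation. -/
theorem ext_low (N : ModuleCat.{v} R) (rs : List R) (hN : ∀ r ∈ rs, ∀ x : N, r • x = 0)
    (M : Type v) [AddCommGroup M] [Module R M] (hreg : IsWeaklyRegular M rs) :
    (∀ p < rs.length, Subsingleton (Ext N (ModuleCat.of R M) p)) ∧
    Nonempty (Ext N (ModuleCat.of R M) rs.length ≃+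
      (N ⟶ ModuleCat.of R (M ⧸ (Ideal.ofList rs • ⊤ : Submodule R M)))) := by
  induction rs generalizing M with
  | nil =>
    refine ⟨by simp, ?_⟩
    obtain ⟨e'⟩ := extEquivOfLinearEquiv N
      (Submodule.quotEquivOfEqBot (Ideal.ofList ([] : List R) • ⊤ : Submodule R M) (by simp)) 0
    exact ⟨e'.symm.trans Ext.addEquiv₀⟩
  | cons r rs ih =>
    rw [isWeaklyRegular_cons_iff] at hreg
    obtain ⟨h1, ⟨e⟩⟩ := ih (fun s hs => hN s (List.mem_cons_of_mem _ hs)) (QuotSMulTop r M) hreg.2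
    have hS := IsSMulRegular.smulShortComplex_shortExact (M := ModuleCat.of R M) hreg.1
    have hz := smul_ext_eq_zero N (ModuleCat.of R M) r (hN r List.mem_cons_self)
    have hlow : ∀ p < (r :: rs).length, Subsingleton (Ext N (ModuleCat.of R M) p) := by
      intro p hp
      refine subsingleton_of_forall_eq 0 fun x => ?_
      cases p with
      | zero =>
        have := hS.mono_f
        refine Ext.postcomp_mk₀_injective_of_mono N ((ModuleCat.of R M).smulShortComplex r).f ?_
        exact (hz 0 x).trans (map_zero _).symm
      | succ p =>
        obtain ⟨y, rfl⟩ := Ext.covariant_sequence_exact₁ N hS x (hz _ x) rfl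
        have := h1 p (by simpa using hp)
        rw [show y = 0 from Subsingleton.elim (α := Ext N (ModuleCat.of R (QuotSMulTop r M)) p) y 0]
        apply Ext.zero_comp
    refine ⟨hlow, ?_⟩
    have := hlow rs.length (by simp)
    let D : Ext N (ModuleCat.of R (QuotSMulTop r M)) rs.length →+
        Ext N (ModuleCat.of R M) (rs.length + 1) :=
      hS.extClass.postcomp N (rfl : rs.length + 1 = rs.length + 1)
    have hD : Function.Bijective D := by
      constructor
      · rw [injective_iff_map_eq_zero]
        intro x hx
        obtain ⟨y, rfl⟩ := Ext.covariant_sequence_exact₃ N hS x rfl hx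
        rw [show y = 0 from Subsingleton.elim (α := Ext N (ModuleCat.of R M) rs.length) y 0]
        apply Ext.zero_comp
      · intro x
        exact Ext.covariant_sequence_exact₁ N hS x (hz _ x) rfl
    let e2 := (Submodule.quotOfListConsSMulTopEquivQuotSMulTopInner M r rs).toModuleIso
    refine ⟨((AddEquiv.ofBijective D hD).symm.trans e).trans
      { toFun := fun f => f ≫ e2.inv
        invFun := fun f => f ≫ e2.hom
        left_inv := fun f => by simp
        right_inv := fun f => by simp
        map_add' := fun f g => by simp }⟩

theorem main_ext (N : ModuleCat.{v} R) (n : ℕ) (us fs : List R) (hu : us.length = n)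
    (hf : fs.length = n) (huN : ∀ r ∈ us, ∀ x : N, r • x = 0) (hfN : ∀ r ∈ fs, ∀ x : N, r • x = 0)
    (M : Type v) [AddCommGroup M] [Module R M] [Module.Projective R M]
    (hureg : IsWeaklyRegular M us) (hfreg : IsWeaklyRegular M fs)
    (eN : N ≅ ModuleCat.of R (M ⧸ (Ideal.ofList us • ⊤ : Submodule R M)))
    (hEnd : Nonempty ((N ⟶ N) ≃+ ℤ)) (p : ℕ) (hp : p ≤ n) :
    Nonempty (Ext N (ModuleCat.of R (M ⧸ (Ideal.ofList fs • ⊤ : Submodule R M))) p ≃+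
      (Fin (n.choose p) → ℤ)) := by
  obtain ⟨e⟩ := hEnd
  have hpd : HasProjectiveDimensionLT N (1 + n) := by
    have : Projective (ModuleCat.of R M) := (IsProjective.iff_projective M).1 inferInstance
    have h := projdim_quot us 1 M hureg inferInstance
    rw [hu] at h
    exact hasProjectiveDimensionLT_of_iso eN.symm _
  obtain ⟨hlow, ⟨htop⟩⟩ := ext_low N us huN M hureg
  rw [hu] at hlow htop
  have h0 : ∀ q, Nonempty (Ext N (ModuleCat.of R M) q ≃+ (Fin (rk n 0 q) → ℤ)) := by
    intro q
    rcases lt_trichotomy q n with h | rfl | h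
    · have := hlow q h
      have hr : rk n 0 q = 0 := by
        unfold rk
        rw [if_pos h.le]
        exact Nat.choose_eq_zero_of_lt (by omega)
      rw [hr]
      exact ⟨⟨⟨fun _ => 0, fun _ => 0, fun _ => Subsingleton.elim _ _, fun _ => Subsingleton.elim _ _⟩,
        fun _ _ => Subsingleton.elim _ _⟩⟩
    · have hr : rk q 0 q = 1 := by simp [rk]
      rw [hr]
      refine ⟨(htop.trans
        { toFun := fun f => f ≫ eN.inv
          invFun := fun f => f ≫ eN.hom
          left_inv := fun f => by simp
          right_inv := fun f => by simp
          map_add' := fun f g => by simp }).trans (e.trans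
          (LinearEquiv.funUnique (Fin 1) ℤ ℤ).symm.toAddEquiv)⟩
    · have := HasProjectiveDimensionLT.subsingleton N (1 + n) q (by omega) (ModuleCat.of R M)
      have hr : rk n 0 q = 0 := by
        unfold rk
        rw [if_neg (by omega)]
      rw [hr]
      exact ⟨⟨⟨fun _ => 0, fun _ => 0, fun _ => Subsingleton.elim _ _, fun _ => Subsingleton.elim _ _⟩,
        fun _ _ => Subsingleton.elim _ _⟩⟩
  have := ext_quot N n fs hfN 0 M hfreg h0 p
  rw [hf, zero_add] at this
  rwa [rk, if_pos hp, Nat.choose_symm hp] at this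

end ExtLaurent

namespace ExtLaurent
section algebra
open RingTheory.Sequence Pointwise MvPolynomial

lemma regular_X (n : ℕ) :
    IsWeaklyRegular (MvPolynomial (Fin n) ℤ)
      (List.ofFn fun i : Fin n => (X i : MvPolynomial (Fin n) ℤ)) := by
  rw [isWeaklyRegular_iff_Fin]
  intro i
  have hi : (i : ℕ) < n := by simpa using i.2
  have hI : (Ideal.ofList ((List.ofFn fun i : Fin n => (X i : MvPolynomial (Fin n) ℤ)).take i)) =
      Ideal.span (X '' {j : Fin n | (j : ℕ) < i}) := by
    unfold Ideal.ofList
    congr 1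
    ext x
    simp only [Set.mem_ofPred_eq, List.mem_take_iff_getElem, Set.mem_image, List.getElem_ofFn,
      List.length_ofFn]
    constructor
    · rintro ⟨k, hk, rfl⟩
      exact ⟨⟨k, by omega⟩, by simp; omega, rfl⟩
    · rintro ⟨j, hj, rfl⟩
      exact ⟨j, by omega, rfl⟩
  rw [isSMulRegular_quotient_iff_mem_of_smul_mem]
  intro x hx
  rw [hI, smul_eq_mul, Ideal.mul_top] at hx ⊢
  rw [mem_ideal_span_X_image] at hx ⊢
  intro m hm
  have h2 : m + Finsupp.single ⟨i, hi⟩ 1 ∈ (x * X (⟨i, hi⟩ : Fin n)).support := by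
    rw [mem_support_iff, coeff_mul_X]
    exact mem_support_iff.mp hm
  obtain ⟨j, hj, hne⟩ := hx (m + Finsupp.single ⟨i, hi⟩ 1) (by
    have : (List.ofFn fun i : Fin n => (X i : MvPolynomial (Fin n) ℤ))[i] = X ⟨i, hi⟩ := by simp
    rw [this, smul_eq_mul, mul_comm]
    exact h2)
  refine ⟨j, hj, ?_⟩
  have : (⟨i, hi⟩ : Fin n) ≠ j := by
    rintro rfl
    exact absurd (show (i : ℕ) < i from hj) (lt_irrefl _)
  simpa [Finsupp.single_apply, this] using hne

/-- translation of variables -/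
noncomputable def translate {n : ℕ} (a : Fin n → ℤ) :
    MvPolynomial (Fin n) ℤ ≃+* MvPolynomial (Fin n) ℤ :=
  RingEquiv.ofRingHom
    (aeval (fun i => (X i - C (a i) : MvPolynomial (Fin n) ℤ))).toRingHom
    (aeval (fun i => (X i + C (a i) : MvPolynomial (Fin n) ℤ))).toRingHom
    (by ext i <;> simp) (by ext i <;> simp)

lemma regular_X_sub (n : ℕ) (a : Fin n → ℤ) :
    IsWeaklyRegular (MvPolynomial (Fin n) ℤ)
      (List.ofFn fun i : Fin n => (X i - C (a i) : MvPolynomial (Fin n) ℤ)) := by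
  refine ((translate a).toAddEquiv.isWeaklyRegular_congr ?_).mp (regular_X n)
  rw [List.forall₂_iff_get]
  refine ⟨by simp, ?_⟩
  intro i h1 h2 x
  simp [translate]

/-- exponents -/
def expo (n : ℕ) : (Fin n →₀ ℕ) →+ (Fin n → ℤ) where
  toFun m i := (m i : ℤ)
  map_zero' := by ext; simp
  map_add' := by intros; ext; simp

lemma expo_inj (n : ℕ) : Function.Injective (expo n) := by
  intro a b h
  ext i
  have := congrFun h i
  simpa [expo] using this

/-- standard inclusion of polynomials into Laurent polynomials -/
noncomputable def incl (n : ℕ) : MvPolynomial (Fin n) ℤ →+* AddMonoidAlgebra ℤ (Fin n → ℤ) :=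
  AddMonoidAlgebra.mapDomainRingHom ℤ (expo n)

lemma incl_monomial (n : ℕ) (m : Fin n →₀ ℕ) (c : ℤ) :
    incl n (monomial m c) = AddMonoidAlgebra.single (expo n m) c := by
  exact AddMonoidAlgebra.mapDomain_single

lemma incl_injective (n : ℕ) : Function.Injective (incl n) :=
  AddMonoidAlgebra.mapDomain_injective (expo_inj n)

lemma incl_X (n : ℕ) (i : Fin n) :
    incl n (X i) = AddMonoidAlgebra.single (Pi.single i 1) 1 := by
  unfold X
  rw [incl_monomial]
  congr 1
  ext j
  simp [expo, Finsupp.single_apply, Pi.single_apply, eq_comm]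

/-- monomials with coefficient one -/
noncomputable def monos (n : ℕ) : Submonoid (MvPolynomial (Fin n) ℤ) :=
  MonoidHom.mrange (monomialOneHom ℤ (Fin n))

lemma isLoc (n : ℕ) :
    letI := (incl n).toAlgebra
    IsLocalization (monos n) (AddMonoidAlgebra ℤ (Fin n → ℤ)) := by
  letI := (incl n).toAlgebra
  have hmem : ∀ m : Fin n →₀ ℕ, monomial m (1:ℤ) ∈ monos n := fun m => ⟨.ofAdd m, rfl⟩
  change IsLocalization (monos n) (AddMonoidAlgebra ℤ (Fin n → ℤ))
  rw [isLocalization_iff]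
  refine ⟨?_, ?_, ?_⟩
  · rintro ⟨_, m, rfl⟩
    refine IsUnit.of_mul_eq_one (AddMonoidAlgebra.single (- expo n m.toAdd) 1) ?_
    change incl n (monomial m.toAdd 1) * _ = 1
    rw [incl_monomial, AddMonoidAlgebra.single_mul_single]
    simp [AddMonoidAlgebra.one_def]
  · intro z
    change ∃ x : MvPolynomial (Fin n) ℤ × monos n, z * incl n x.2 = incl n x.1
    induction z using AddMonoidAlgebra.induction_linear with
    | zero => exact ⟨(0, 1), by simp⟩
    | add f g hf hg =>
      obtain ⟨⟨a, s⟩, h1⟩ := hf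
      obtain ⟨⟨b, t⟩, h2⟩ := hg
      refine ⟨(a * t + b * s, s * t), ?_⟩
      simp only [Submonoid.coe_mul, map_mul, map_add] at h1 h2 ⊢
      rw [← h1, ← h2]
      ring
    | single g c =>
      refine ⟨(monomial (Finsupp.equivFunOnFinite.symm fun i => (g i + |g i|).toNat) c,
        ⟨monomial (Finsupp.equivFunOnFinite.symm fun i => (|g i|).toNat) 1, hmem _⟩), ?_⟩
      simp only [incl_monomial]
      rw [AddMonoidAlgebra.single_mul_single, mul_one]
      congr 1
      ext i
      have h1 := neg_abs_le (g i)
      have h2 := abs_nonneg (g i)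
      simp [expo]
      omega
  · intro x y h
    exact ⟨1, by rw [incl_injective n h]⟩

lemma regular_us (n : ℕ) :
    IsWeaklyRegular (AddMonoidAlgebra ℤ (Fin n → ℤ))
      (List.ofFn fun i : Fin n => (AddMonoidAlgebra.single (Pi.single i 1) 1 - 1 :
        AddMonoidAlgebra ℤ (Fin n → ℤ))) := by
  letI := (incl n).toAlgebra
  haveI := isLoc n
  haveI : Module.Flat (MvPolynomial (Fin n) ℤ) (AddMonoidAlgebra ℤ (Fin n → ℤ)) :=
    IsLocalization.flat _ (monos n)
  have := (regular_X_sub n 1).of_flat (S := AddMonoidAlgebra ℤ (Fin n → ℤ))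
  rw [List.map_ofFn] at this
  have key : (List.ofFn fun i : Fin n => (AddMonoidAlgebra.single (Pi.single i 1) 1 - 1 :
        AddMonoidAlgebra ℤ (Fin n → ℤ))) = List.ofFn ((algebraMap (MvPolynomial (Fin n) ℤ)
          (AddMonoidAlgebra ℤ (Fin n → ℤ))) ∘ fun i : Fin n =>
            (X i - C ((1 : Fin n → ℤ) i) : MvPolynomial (Fin n) ℤ)) := by
    congr 1
    ext1 i
    change _ = incl n _
    simp [incl_X]
  rw [key]
  exact this

lemma regular_fs (n : ℕ) (φ : MvPolynomial (Fin n) ℤ →+* AddMonoidAlgebra ℤ (Fin n → ℤ))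
    (a : Fin n → ℤ)
    (h : @Module.Flat (MvPolynomial (Fin n) ℤ) (AddMonoidAlgebra ℤ (Fin n → ℤ)) _ _
      φ.toAlgebra.toModule) :
    IsWeaklyRegular (AddMonoidAlgebra ℤ (Fin n → ℤ))
      ((List.ofFn fun i : Fin n => (X i - C (a i) : MvPolynomial (Fin n) ℤ)).map φ) := by
  letI := φ.toAlgebra
  exact (regular_X_sub n a).of_flat (S := AddMonoidAlgebra ℤ (Fin n → ℤ))


lemma ker_psi (n : ℕ) (ψ : MvPolynomial (Fin n) ℤ →+* ℤ) :
    Ideal.ofList (List.ofFn fun i : Fin n => (X i - C (ψ (X i)) : MvPolynomial (Fin n) ℤ)) =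
      RingHom.ker ψ := by
  have hC : ∀ c : ℤ, ψ (C c) = c := fun c => by
    exact (congrArg (fun f : ℤ →+* ℤ => f c) (Subsingleton.elim (ψ.comp C) (RingHom.id ℤ)))
  set I := Ideal.ofList (List.ofFn fun i : Fin n => (X i - C (ψ (X i)) : MvPolynomial (Fin n) ℤ))
    with hI
  have hX : ∀ i, X i - C (ψ (X i)) ∈ I := fun i => by
    apply Ideal.subset_span
    simp
  apply le_antisymm
  · rw [hI, Ideal.ofList, Ideal.span_le]
    intro x hx
    obtain ⟨i, rfl⟩ : ∃ i, X i - C (ψ (X i)) = x := by simpa [List.mem_ofFn] using hx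
    simp [RingHom.mem_ker, hC]
  · have key : ∀ p, p - C (ψ p) ∈ I := by
      intro p
      induction p using MvPolynomial.induction_on with
      | C a => rw [hC, sub_self]; exact I.zero_mem
      | add p q hp hq =>
        have := I.add_mem hp hq
        convert this using 1
        simp only [map_add]
        ring
      | mul_X p i hp =>
        have := I.add_mem (I.mul_mem_right (X i) hp) (I.mul_mem_left (C (ψ p)) (hX i))
        convert this using 1
        simp only [map_mul]
        ring
    intro p hp
    have := key p
    rwa [RingHom.mem_ker.mp hp, map_zero, sub_zero] at this

lemma ker_eps (n : ℕ) (ε : AddMonoidAlgebra ℤ (Fin n → ℤ) →+* ℤ)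
    (hε : ∀ g : Fin n → ℤ, ε (AddMonoidAlgebra.single g 1) = 1) :
    Ideal.ofList (List.ofFn fun i : Fin n => (AddMonoidAlgebra.single (Pi.single i 1) 1 - 1 :
        AddMonoidAlgebra ℤ (Fin n → ℤ))) = RingHom.ker ε := by
  set I := Ideal.ofList (List.ofFn fun i : Fin n => (AddMonoidAlgebra.single (Pi.single i 1) 1 - 1 :
        AddMonoidAlgebra ℤ (Fin n → ℤ))) with hI
  have hX : ∀ i : Fin n, (AddMonoidAlgebra.single (Pi.single i 1) 1 - 1 :
        AddMonoidAlgebra ℤ (Fin n → ℤ)) ∈ I := fun i => by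
    apply Ideal.subset_span
    simp
  apply le_antisymm
  · rw [hI, Ideal.ofList, Ideal.span_le]
    intro x hx
    obtain ⟨i, rfl⟩ : ∃ i : Fin n, (AddMonoidAlgebra.single (Pi.single i 1) 1 - 1 :
        AddMonoidAlgebra ℤ (Fin n → ℤ)) = x := by simpa [List.mem_ofFn] using hx
    simp [RingHom.mem_ker, hε]
  · let H : AddSubgroup (Fin n → ℤ) :=
      { carrier := {g | (AddMonoidAlgebra.single g 1 - 1 : AddMonoidAlgebra ℤ (Fin n → ℤ)) ∈ I}
        zero_mem' := by
          change (AddMonoidAlgebra.single 0 1 - 1 : AddMonoidAlgebra ℤ (Fin n → ℤ)) ∈ I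
          rw [← AddMonoidAlgebra.one_def, sub_self]
          exact I.zero_mem
        add_mem' := by
          intro a b ha hb
          have := I.add_mem (I.mul_mem_right (AddMonoidAlgebra.single b 1) ha) hb
          change (AddMonoidAlgebra.single (a + b) 1 - 1 : AddMonoidAlgebra ℤ (Fin n → ℤ)) ∈ I
          convert this using 1
          rw [sub_mul, AddMonoidAlgebra.single_mul_single]
          simp
        neg_mem' := by
          intro a ha
          have := I.neg_mem (I.mul_mem_right (AddMonoidAlgebra.single (-a) 1) ha)
          change (AddMonoidAlgebra.single (-a) 1 - 1 : AddMonoidAlgebra ℤ (Fin n → ℤ)) ∈ I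
          convert this using 1
          rw [sub_mul, AddMonoidAlgebra.single_mul_single]
          simp [AddMonoidAlgebra.one_def] }
    have hH : ∀ g, g ∈ H := by
      intro g
      have : g = ∑ i, g i • (Pi.single i (1 : ℤ) : Fin n → ℤ) := by
        ext j
        simp [Finset.sum_apply, Pi.single_apply]
      rw [this]
      exact H.sum_mem fun i _ => H.zsmul_mem (hX i) _
    have hs : ∀ (g : Fin n → ℤ) (c : ℤ), (AddMonoidAlgebra.single g c :
        AddMonoidAlgebra ℤ (Fin n → ℤ)) = (c : AddMonoidAlgebra ℤ (Fin n → ℤ)) *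
          AddMonoidAlgebra.single g 1 := by
      intro g c
      rw [← zsmul_eq_mul, AddMonoidAlgebra.smul_single]
      simp
    have key : ∀ p, p - ((ε p : ℤ) : AddMonoidAlgebra ℤ (Fin n → ℤ)) ∈ I := by
      intro p
      induction p using AddMonoidAlgebra.induction_linear with
      | zero => simp
      | add p q hp hq =>
        have := I.add_mem hp hq
        convert this using 1
        push_cast [map_add]
        ring
      | single g c =>
        have := I.mul_mem_left (c : AddMonoidAlgebra ℤ (Fin n → ℤ)) (hH g)
        convert this using 1
        rw [hs g c, map_mul, hε, map_intCast]
        push_cast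
        ring
    intro p hp
    have := key p
    rwa [RingHom.mem_ker.mp hp, Int.cast_zero, sub_zero] at this

end algebra

section modules
universe u
variable {S : Type} [CommRing S] (ε : S →+* ℤ)

/-- `ℤ` as a module through a ring homomorphism. -/
noncomputable abbrev Zmod : ModuleCat.{0} S := (ModuleCat.restrictScalars ε).obj (ModuleCat.of ℤ ℤ)

lemma Zmod_smul (s : S) (x : ℤ) : s • (show Zmod ε from x) = (show Zmod ε from (ε s * x : ℤ)) := rfl

/-- the map `s ↦ s • 1` -/
noncomputable def toZmod : S →ₗ[S] Zmod ε :=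
  LinearMap.toSpanSingleton S (Zmod ε) (show Zmod ε from (1 : ℤ))

lemma toZmod_apply (s : S) : toZmod ε s = (show Zmod ε from ε s) := by
  rw [toZmod, LinearMap.toSpanSingleton_apply, Zmod_smul, mul_one]

lemma toZmod_surj : Function.Surjective (toZmod ε) := by
  intro x
  refine ⟨((show ℤ from x : ℤ) : S), ?_⟩
  rw [toZmod_apply, map_intCast]
  rfl

/-- first isomorphism theorem -/
noncomputable def quotEquivZmod (I : Ideal S) (h : I = RingHom.ker ε) :
    (S ⧸ I) ≃ₗ[S] Zmod ε :=
  (Submodule.quotEquivOfEq _ _ (by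
    ext x
    rw [h, LinearMap.mem_ker, toZmod_apply]
    exact RingHom.mem_ker)).trans
    ((toZmod ε).quotKerEquivOfSurjective (toZmod_surj ε))

lemma zmod_end : Nonempty ((Zmod ε ⟶ Zmod ε) ≃+ ℤ) := by
  refine ⟨{ toFun := fun f => (show ℤ from f.hom (show Zmod ε from (1 : ℤ)))
            invFun := fun k => k • 𝟙 (Zmod ε)
            left_inv := ?_, right_inv := ?_, map_add' := ?_ }⟩
  · intro f
    ext x
    obtain ⟨s, rfl⟩ := toZmod_surj ε x
    rw [toZmod, LinearMap.toSpanSingleton_apply, map_smul]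
    rw [map_smul]
    congr 1
    change (show ℤ from f.hom (show Zmod ε from (1 : ℤ))) • (1 : ℤ) = _
    rw [smul_eq_mul, mul_one]
  · intro k
    change k • (1 : ℤ) = k
    simp
  · intro f g
    rfl

end modules
end ExtLaurent

/-- For `S = ℤ[t₁^±,…,tₙ^±]` the group ring of `ℤⁿ`, a ring homomorphism
`φ : ℤ[x₁,…,xₙ] → S` making `S` a free `ℤ[x₁,…,xₙ]`-module, and the augmentation `ε : S → ℤ`
sending each group element to `1` (so `ℤ` is an `S`-module via `ε` and a `ℤ[x₁,…,xₙ]`-module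
via `ε ∘ φ`), for every `0 ≤ p ≤ n` the abelian group `Ext^p_S(ℤ, S ⊗_{ℤ[x₁,…,xₙ]} ℤ)` is free
of rank `n.choose p`. -/
theorem ext_laurent_base_change_free_of_rank_choose
    (n p : ℕ) (hp : p ≤ n)
    (φ : MvPolynomial (Fin n) ℤ →+* AddMonoidAlgebra ℤ (Fin n → ℤ))
    (ε : AddMonoidAlgebra ℤ (Fin n → ℤ) →+* ℤ)
    (hε : ∀ g : Fin n → ℤ, ε (AddMonoidAlgebra.single g 1) = 1) :
    letI : Algebra (MvPolynomial (Fin n) ℤ) (AddMonoidAlgebra ℤ (Fin n → ℤ)) := φ.toAlgebra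
    ∀ _ : Module.Free (MvPolynomial (Fin n) ℤ) (AddMonoidAlgebra ℤ (Fin n → ℤ)),
      Nonempty
        ((((Ext ℤ (ModuleCat (AddMonoidAlgebra ℤ (Fin n → ℤ))) p).obj
              (Opposite.op ((ModuleCat.restrictScalars ε).obj (ModuleCat.of ℤ ℤ)))).obj
            (ModuleCat.of (AddMonoidAlgebra ℤ (Fin n → ℤ))
              (TensorProduct (MvPolynomial (Fin n) ℤ) (AddMonoidAlgebra ℤ (Fin n → ℤ))
                ((ModuleCat.restrictScalars (ε.comp φ)).obj (ModuleCat.of ℤ ℤ))))) ≃+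
          (Fin (n.choose p) → ℤ)) := by
  intro hfree
  let ψ : MvPolynomial (Fin n) ℤ →+* ℤ := ε.comp φ
  let fs0 : List (MvPolynomial (Fin n) ℤ) :=
    List.ofFn fun i : Fin n => (MvPolynomial.X i - MvPolynomial.C (ψ (MvPolynomial.X i)))
  let fs : List (AddMonoidAlgebra ℤ (Fin n → ℤ)) := fs0.map φ
  let us : List (AddMonoidAlgebra ℤ (Fin n → ℤ)) := List.ofFn fun i : Fin n => (AddMonoidAlgebra.single (Pi.single i 1) 1 - 1 : (AddMonoidAlgebra ℤ (Fin n → ℤ)))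
  let N : ModuleCat.{0} (AddMonoidAlgebra ℤ (Fin n → ℤ)) := ExtLaurent.Zmod ε
  have hkerψ : Ideal.ofList fs0 = RingHom.ker ψ := ExtLaurent.ker_psi n ψ
  have hkerε : Ideal.ofList us = RingHom.ker ε := ExtLaurent.ker_eps n ε hε
  have hkill : ∀ r : (AddMonoidAlgebra ℤ (Fin n → ℤ)), ε r = 0 → ∀ x : N, r • x = 0 := by
    intro r hr x
    refine (ExtLaurent.Zmod_smul ε r x).trans ?_
    rw [hr]
    exact zero_mul (show ℤ from x)
  have huN : ∀ r ∈ us, ∀ x : N, r • x = 0 := by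
    intro r hr
    apply hkill
    have : r ∈ RingHom.ker ε := hkerε ▸ Ideal.subset_span hr
    exact this
  have hfN : ∀ r ∈ fs, ∀ x : N, r • x = 0 := by
    intro r hr
    obtain ⟨q, hq, rfl⟩ := List.mem_map.mp hr
    apply hkill
    have : q ∈ RingHom.ker ψ := hkerψ ▸ Ideal.subset_span hq
    exact this
  have hflat : @Module.Flat (MvPolynomial (Fin n) ℤ) (AddMonoidAlgebra ℤ (Fin n → ℤ)) _ _
      φ.toAlgebra.toModule := by
    letI : Algebra (MvPolynomial (Fin n) ℤ) (AddMonoidAlgebra ℤ (Fin n → ℤ)) := φ.toAlgebra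
    haveI : Module.Free (MvPolynomial (Fin n) ℤ) (AddMonoidAlgebra ℤ (Fin n → ℤ)) := hfree
    infer_instance
  have eN : N ≅ ModuleCat.of (AddMonoidAlgebra ℤ (Fin n → ℤ)) ((AddMonoidAlgebra ℤ (Fin n → ℤ)) ⧸ (Ideal.ofList us • ⊤ : Submodule (AddMonoidAlgebra ℤ (Fin n → ℤ)) (AddMonoidAlgebra ℤ (Fin n → ℤ)))) :=
    (ExtLaurent.quotEquivZmod ε (Ideal.ofList us • ⊤ : Submodule (AddMonoidAlgebra ℤ (Fin n → ℤ)) (AddMonoidAlgebra ℤ (Fin n → ℤ))) (by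
      rw [smul_eq_mul, Ideal.mul_top, hkerε])).symm.toModuleIso
  obtain ⟨e3⟩ := ExtLaurent.main_ext N n us fs (by simp [us]) (by simp [fs, fs0]) huN hfN (AddMonoidAlgebra ℤ (Fin n → ℤ))
    (ExtLaurent.regular_us n) (ExtLaurent.regular_fs n φ _ hflat) eN (ExtLaurent.zmod_end ε) p hp
  letI : Algebra (MvPolynomial (Fin n) ℤ) (AddMonoidAlgebra ℤ (Fin n → ℤ)) := φ.toAlgebra
  let e1 : TensorProduct (MvPolynomial (Fin n) ℤ) (AddMonoidAlgebra ℤ (Fin n → ℤ)) (ExtLaurent.Zmod ψ) ≃ₗ[(AddMonoidAlgebra ℤ (Fin n → ℤ))]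
      ((AddMonoidAlgebra ℤ (Fin n → ℤ)) ⧸ (Ideal.ofList fs • ⊤ : Submodule (AddMonoidAlgebra ℤ (Fin n → ℤ)) (AddMonoidAlgebra ℤ (Fin n → ℤ)))) :=
    (TensorProduct.AlgebraTensorModule.congr (LinearEquiv.refl (AddMonoidAlgebra ℤ (Fin n → ℤ)) (AddMonoidAlgebra ℤ (Fin n → ℤ)))
      (ExtLaurent.quotEquivZmod ψ _ hkerψ).symm).trans
    ((Algebra.TensorProduct.quotIdealMapEquivTensorQuot (AddMonoidAlgebra ℤ (Fin n → ℤ)) (Ideal.ofList fs0)).symm.toLinearEquiv.trans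
      (Submodule.quotEquivOfEq _ _ (by
        rw [smul_eq_mul, Ideal.mul_top, Ideal.map_ofList]
        rfl)))
  obtain ⟨e2⟩ := ExtLaurent.extEquivOfLinearEquiv N e1 p
  exact ⟨((ExtLaurent.oldExtEquiv (A := ℤ) (X := N)
    (ModuleCat.of (AddMonoidAlgebra ℤ (Fin n → ℤ)) (TensorProduct (MvPolynomial (Fin n) ℤ) (AddMonoidAlgebra ℤ (Fin n → ℤ)) (ExtLaurent.Zmod ψ)))
    (projectiveResolution N) p).trans e2).trans e3⟩
end
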